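/- Let 𝒮 be the algebra with generators s_ij (1 ≤ i,j ≤ 2n) and s_{ii′}^{−1} (i = 1,3,…,2n−1), with defining relations: s_ij = 0 for i < j with j ≠ i′; s_{i′i′} s_ii − q² s_{i′i} s_{ii′} = q³ and s_{ii′} s_{ii′}^{−1} = s_{ii′}^{−1} s_{ii′} = 1 for odd i; and the reflection equation R S₁ Rᵗ S₂ = S₂ Rᵗ S₁ R for S = Σ s_ij⊗E_ij. Then 𝒮 is linearly spanned by the ordered monomials ∏_{i=1,3,…,2n−1} s_{i1}^{k_{i1}} s_{i2}^{k_{i2}} ⋯ s_{ii′}^{k_{ii′}} s_{i′i′}^{k_{i′i′}} s_{i′1}^{k_{i′1}} ⋯ s_{i′,i′−2}^{k_{i′,i′−2}}, where the exponents k_{ii′} (i odd) are arbitrary integers and all remaining exponents are nonnegative integers. -/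

import Mathlib

noncomputable section

open scoped TensorProduct

abbrev FF : Type := RatFunc ℂ

def qq : FF := RatFunc.X

/-! Constant R-matrices acting in `ℂ^N ⊗ ℂ^N`, written as matrices indexed by pairs. -/

def Rc (F : Type) [Field F] (q : F) (N : ℕ) :
    Matrix (Fin N × Fin N) (Fin N × Fin N) F := Matrix.of fun p r =>
  (if p = r then (if p.1 = p.2 then q else 1) else 0)
  + (if p.1 = r.2 ∧ p.2 = r.1 ∧ p.1 < p.2 then q - q⁻¹ else 0)

/-- `R` transposed in the first tensor factor. -/
def Rct (F : Type) [Field F] (q : F) (N : ℕ) :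
    Matrix (Fin N × Fin N) (Fin N × Fin N) F :=
  Matrix.of fun p r => Rc F q N (r.1, p.2) (p.1, r.2)

def Rtil (F : Type) [Field F] (q : F) (N : ℕ) :
    Matrix (Fin N × Fin N) (Fin N × Fin N) F := Matrix.of fun p r =>
  (if p = r then (if p.1 = p.2 then q⁻¹ else 1) else 0)
  + (if p.1 = r.2 ∧ p.2 = r.1 ∧ p.2 < p.1 then q⁻¹ - q else 0)

def Rtilt (F : Type) [Field F] (q : F) (N : ℕ) :
    Matrix (Fin N × Fin N) (Fin N × Fin N) F :=
  Matrix.of fun p r => Rtil F q N (r.1, p.2) (p.1, r.2)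

/-- `S ↦ S ⊗ 1` (action in the first copy of `End ℂ^N`). -/
def amp1 {A : Type} [Ring A] {N : ℕ} (M : Matrix (Fin N) (Fin N) A) :
    Matrix (Fin N × Fin N) (Fin N × Fin N) A :=
  Matrix.of fun p r => if p.2 = r.2 then M p.1 r.1 else 0

/-- `S ↦ 1 ⊗ S` (action in the second copy of `End ℂ^N`). -/
def amp2 {A : Type} [Ring A] {N : ℕ} (M : Matrix (Fin N) (Fin N) A) :
    Matrix (Fin N × Fin N) (Fin N × Fin N) A :=
  Matrix.of fun p r => if p.1 = r.1 then M p.2 r.2 else 0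

/-- A scalar matrix viewed as a matrix over an `F`-algebra `A`. -/
def liftF (F : Type) [Field F] {A : Type} [Ring A] [Algebra F A] {m : Type}
    (M : Matrix m m F) : Matrix m m A := M.map (algebraMap F A)

/-- Left hand side `R S₁ Rᵗ S₂` of the reflection equation. -/
def reflLHS (F : Type) [Field F] (q : F) {N : ℕ} {A : Type} [Ring A] [Algebra F A]
    (S : Matrix (Fin N) (Fin N) A) : Matrix (Fin N × Fin N) (Fin N × Fin N) A :=
  liftF F (Rc F q N) * amp1 S * liftF F (Rct F q N) * amp2 S

/-- Right hand side `S₂ Rᵗ S₁ R` of the reflection equation. -/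
def reflRHS (F : Type) [Field F] (q : F) {N : ℕ} {A : Type} [Ring A] [Algebra F A]
    (S : Matrix (Fin N) (Fin N) A) : Matrix (Fin N × Fin N) (Fin N × Fin N) A :=
  amp2 S * liftF F (Rct F q N) * amp1 S * liftF F (Rc F q N)

/-- The list of index pairs `(i,j)` in lexicographic order. -/
def lexPairs (N : ℕ) : List (Fin N × Fin N) :=
  (List.finRange N).flatMap fun i => (List.finRange N).map fun j => (i, j)

/-! The generic matrix of generators. -/

def Sfree (F : Type) [Field F] (N : ℕ) :
    Matrix (Fin N) (Fin N) (FreeAlgebra F (Fin N × Fin N)) :=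
  Matrix.of fun i j => FreeAlgebra.ι F (i, j)

/-- Defining relations: only the reflection equation. -/
inductive Rel0 (F : Type) [Field F] (q : F) (N : ℕ) :
    FreeAlgebra F (Fin N × Fin N) → FreeAlgebra F (Fin N × Fin N) → Prop
  | refl (p r : Fin N × Fin N) :
      Rel0 F q N (reflLHS F q (Sfree F N) p r) (reflRHS F q (Sfree F N) p r)

/-- The algebra with generators `s_ij` and the reflection equation as defining relations. -/
abbrev Alg0 (F : Type) [Field F] (q : F) (N : ℕ) := RingQuot (Rel0 F q N)

def s0 (F : Type) [Field F] (q : F) (N : ℕ) (i j : Fin N) : Alg0 F q N :=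
  RingQuot.mkAlgHom F (Rel0 F q N) (FreeAlgebra.ι F (i, j))

/-- Defining relations of the presented algebra `𝒮` of the orthogonal case. -/
inductive OSRel (F : Type) [Field F] (q : F) (N : ℕ) :
    FreeAlgebra F (Fin N × Fin N) → FreeAlgebra F (Fin N × Fin N) → Prop
  | tri (i j : Fin N) (h : i < j) : OSRel F q N (FreeAlgebra.ι F (i, j)) 0
  | diag (i : Fin N) : OSRel F q N (FreeAlgebra.ι F (i, i)) 1
  | refl (p r : Fin N × Fin N) :
      OSRel F q N (reflLHS F q (Sfree F N) p r) (reflRHS F q (Sfree F N) p r)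

abbrev AlgOS (F : Type) [Field F] (q : F) (N : ℕ) := RingQuot (OSRel F q N)

def sOS (F : Type) [Field F] (q : F) (N : ℕ) (i j : Fin N) : AlgOS F q N :=
  RingQuot.mkAlgHom F (OSRel F q N) (FreeAlgebra.ι F (i, j))

/-! The quantized enveloping algebra `U_q(gl_N)` by its RTT presentation. -/

abbrev GlGen (N : ℕ) := (Fin N × Fin N) ⊕ (Fin N × Fin N)

def Tfree (F : Type) [Field F] (N : ℕ) :
    Matrix (Fin N) (Fin N) (FreeAlgebra F (GlGen N)) :=
  Matrix.of fun i j => FreeAlgebra.ι F (Sum.inl (i, j))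

def Tbfree (F : Type) [Field F] (N : ℕ) :
    Matrix (Fin N) (Fin N) (FreeAlgebra F (GlGen N)) :=
  Matrix.of fun i j => FreeAlgebra.ι F (Sum.inr (i, j))

/-- `R X₁ Y₂` -/
def rttLHS (F : Type) [Field F] (q : F) {N : ℕ} {A : Type} [Ring A] [Algebra F A]
    (X Y : Matrix (Fin N) (Fin N) A) : Matrix (Fin N × Fin N) (Fin N × Fin N) A :=
  liftF F (Rc F q N) * amp1 X * amp2 Y

/-- `Y₂ X₁ R` -/
def rttRHS (F : Type) [Field F] (q : F) {N : ℕ} {A : Type} [Ring A] [Algebra F A]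
    (X Y : Matrix (Fin N) (Fin N) A) : Matrix (Fin N × Fin N) (Fin N × Fin N) A :=
  amp2 Y * amp1 X * liftF F (Rc F q N)

inductive GlRel (F : Type) [Field F] (q : F) (N : ℕ) :
    FreeAlgebra F (GlGen N) → FreeAlgebra F (GlGen N) → Prop
  | t_zero (i j : Fin N) (h : i < j) : GlRel F q N (Tfree F N i j) 0
  | tb_zero (i j : Fin N) (h : j < i) : GlRel F q N (Tbfree F N i j) 0
  | t_tb (i : Fin N) : GlRel F q N (Tfree F N i i * Tbfree F N i i) 1
  | tb_t (i : Fin N) : GlRel F q N (Tbfree F N i i * Tfree F N i i) 1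
  | rtt (p r : Fin N × Fin N) :
      GlRel F q N (rttLHS F q (Tfree F N) (Tfree F N) p r)
        (rttRHS F q (Tfree F N) (Tfree F N) p r)
  | rtbtb (p r : Fin N × Fin N) :
      GlRel F q N (rttLHS F q (Tbfree F N) (Tbfree F N) p r)
        (rttRHS F q (Tbfree F N) (Tbfree F N) p r)
  | rtbt (p r : Fin N × Fin N) :
      GlRel F q N (rttLHS F q (Tbfree F N) (Tfree F N) p r)
        (rttRHS F q (Tbfree F N) (Tfree F N) p r)

/-- The quantized enveloping algebra `U_q(gl_N)`. -/
abbrev UqGl (F : Type) [Field F] (q : F) (N : ℕ) := RingQuot (GlRel F q N)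

def tE (F : Type) [Field F] (q : F) (N : ℕ) (i j : Fin N) : UqGl F q N :=
  RingQuot.mkAlgHom F (GlRel F q N) (FreeAlgebra.ι F (Sum.inl (i, j)))

def tbE (F : Type) [Field F] (q : F) (N : ℕ) (i j : Fin N) : UqGl F q N :=
  RingQuot.mkAlgHom F (GlRel F q N) (FreeAlgebra.ι F (Sum.inr (i, j)))

/-- The entries `s_ij = Σ_a t_ia t̄_ja` of `S = T T̄ᵗ`. -/
def sE (F : Type) [Field F] (q : F) (N : ℕ) (i j : Fin N) : UqGl F q N :=
  ∑ a : Fin N, tE F q N i a * tbE F q N j a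

/-- The twisted quantized enveloping algebra `U^tw_q(o_N)` as a subalgebra of `U_q(gl_N)`. -/
def UtwO (F : Type) [Field F] (q : F) (N : ℕ) : Subalgebra F (UqGl F q N) :=
  Algebra.adjoin F {x | ∃ i j, x = sE F q N i j}

/-! Symplectic (finite) case. -/

/-- `2k` as an element of `Fin (2n)` (the 0-based version of the odd index `2k-1`). -/
def fe (n : ℕ) (k : Fin n) : Fin (2 * n) := ⟨2 * k.val, by have := k.isLt; omega⟩

/-- `2k+1` as an element of `Fin (2n)` (the 0-based version of the even index `2k`). -/
def fo (n : ℕ) (k : Fin n) : Fin (2 * n) := ⟨2 * k.val + 1, by have := k.isLt; omega⟩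

/-- The entries `s_ij` of `S = T G T̄ᵗ` in `U_q(gl_2n)`. -/
def sSp (F : Type) [Field F] (q : F) (n : ℕ) (i j : Fin (2 * n)) : UqGl F q (2 * n) :=
  algebraMap F _ q * ∑ a : Fin n, tE F q (2 * n) i (fe n a) * tbE F q (2 * n) j (fo n a)
    - ∑ a : Fin n, tE F q (2 * n) i (fo n a) * tbE F q (2 * n) j (fe n a)

abbrev SpGen (n : ℕ) := (Fin (2 * n) × Fin (2 * n)) ⊕ Fin n

def SpFreeS (F : Type) [Field F] (n : ℕ) :
    Matrix (Fin (2 * n)) (Fin (2 * n)) (FreeAlgebra F (SpGen n)) :=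
  Matrix.of fun i j => FreeAlgebra.ι F (Sum.inl (i, j))

/-- Defining relations of the presented algebra `𝒮` of the symplectic case. -/
inductive SpRel (F : Type) [Field F] (q : F) (n : ℕ) :
    FreeAlgebra F (SpGen n) → FreeAlgebra F (SpGen n) → Prop
  | tri (i j : Fin (2 * n)) (h : i < j) (h' : ¬(i.val % 2 = 0 ∧ j.val = i.val + 1)) :
      SpRel F q n (FreeAlgebra.ι F (Sum.inl (i, j))) 0
  | quad (k : Fin n) :
      SpRel F q n
        (FreeAlgebra.ι F (Sum.inl (fo n k, fo n k)) * FreeAlgebra.ι F (Sum.inl (fe n k, fe n k)))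
        (algebraMap F _ (q ^ 2) *
            (FreeAlgebra.ι F (Sum.inl (fo n k, fe n k)) *
              FreeAlgebra.ι F (Sum.inl (fe n k, fo n k)))
          + algebraMap F _ (q ^ 3))
  | invR (k : Fin n) :
      SpRel F q n
        (FreeAlgebra.ι F (Sum.inl (fe n k, fo n k)) * FreeAlgebra.ι F (Sum.inr k)) 1
  | invL (k : Fin n) :
      SpRel F q n
        (FreeAlgebra.ι F (Sum.inr k) * FreeAlgebra.ι F (Sum.inl (fe n k, fo n k))) 1
  | refl (p r : Fin (2 * n) × Fin (2 * n)) :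
      SpRel F q n (reflLHS F q (SpFreeS F n) p r) (reflRHS F q (SpFreeS F n) p r)

abbrev AlgSp (F : Type) [Field F] (q : F) (n : ℕ) := RingQuot (SpRel F q n)

def sSpP (F : Type) [Field F] (q : F) (n : ℕ) (i j : Fin (2 * n)) : AlgSp F q n :=
  RingQuot.mkAlgHom F (SpRel F q n) (FreeAlgebra.ι F (Sum.inl (i, j)))

def sInvP (F : Type) [Field F] (q : F) (n : ℕ) (k : Fin n) : AlgSp F q n :=
  RingQuot.mkAlgHom F (SpRel F q n) (FreeAlgebra.ι F (Sum.inr k))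

/-- row `i = 2k` of the symplectic ordered monomial: positions `(i,0),…,(i,2k)`. -/
def rowA (n : ℕ) (k : Fin n) : List (Fin (2 * n) × Fin (2 * n)) :=
  ((List.finRange (2 * n)).filter fun j => j.val ≤ 2 * k.val).map fun j => (fe n k, j)

/-- row `i' = 2k+1` of the symplectic ordered monomial: positions `(i',0),…,(i',2k-1)`. -/
def rowB (n : ℕ) (k : Fin n) : List (Fin (2 * n) × Fin (2 * n)) :=
  ((List.finRange (2 * n)).filter fun j => j.val + 2 ≤ 2 * k.val + 1).map fun j => (fo n k, j)

/-- The ordered monomials of the symplectic case, with an arbitrary integer exponent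
on each `s_{i i'}` and nonnegative exponents elsewhere. -/
def monomSp {A : Type} [Ring A] (n : ℕ) (s : Fin (2 * n) × Fin (2 * n) → A) (sI : Fin n → A)
    (kN : Fin (2 * n) × Fin (2 * n) → ℕ) (kZ : Fin n → ℤ) : A :=
  ((List.finRange n).map fun k =>
    ((rowA n k).map fun p => s p ^ kN p).prod *
      (if 0 ≤ kZ k then s (fe n k, fo n k) ^ (kZ k).toNat else sI k ^ (-(kZ k)).toNat) *
      s (fo n k, fo n k) ^ kN (fo n k, fo n k) *
      ((rowB n k).map fun p => s p ^ kN p).prod).prod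

/-! Affine (twisted q-Yangian) machinery.  Series are treated coefficientwise. -/

/-- `z1 S r` is the coefficient matrix (in the first copy) of a series indexed by
nonnegative integers, extended by zero to `ℤ`. -/
def z1 {A : Type} [Ring A] {N : ℕ} (S : ℕ → Matrix (Fin N) (Fin N) A) (r : ℤ) :
    Matrix (Fin N × Fin N) (Fin N × Fin N) A :=
  if 0 ≤ r then amp1 (S r.toNat) else 0

def z2 {A : Type} [Ring A] {N : ℕ} (S : ℕ → Matrix (Fin N) (Fin N) A) (r : ℤ) :
    Matrix (Fin N × Fin N) (Fin N × Fin N) A :=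
  if 0 ≤ r then amp2 (S r.toNat) else 0

/-- Coefficient of `u^a v^b` in `R(u,v) S₁(u) Rᵗ(u⁻¹,v) S₂(v)`,
using `R(u,v) = u R̃ - v R` and `Rᵗ(u⁻¹,v) = u⁻¹ R̃ᵗ - v Rᵗ`. -/
def affLHS (F : Type) [Field F] (q : F) {N : ℕ} {A : Type} [Ring A] [Algebra F A]
    (S : ℕ → Matrix (Fin N) (Fin N) A) (a b : ℤ) :
    Matrix (Fin N × Fin N) (Fin N × Fin N) A :=
  liftF F (Rtil F q N) * z1 S (-a) * liftF F (Rtilt F q N) * z2 S (-b)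
    - liftF F (Rtil F q N) * z1 S (1 - a) * liftF F (Rct F q N) * z2 S (1 - b)
    - liftF F (Rc F q N) * z1 S (-1 - a) * liftF F (Rtilt F q N) * z2 S (1 - b)
    + liftF F (Rc F q N) * z1 S (-a) * liftF F (Rct F q N) * z2 S (2 - b)

/-- Coefficient of `u^a v^b` in `S₂(v) Rᵗ(u⁻¹,v) S₁(u) R(u,v)`. -/
def affRHS (F : Type) [Field F] (q : F) {N : ℕ} {A : Type} [Ring A] [Algebra F A]
    (S : ℕ → Matrix (Fin N) (Fin N) A) (a b : ℤ) :
    Matrix (Fin N × Fin N) (Fin N × Fin N) A :=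
  z2 S (-b) * liftF F (Rtilt F q N) * z1 S (-a) * liftF F (Rtil F q N)
    - z2 S (1 - b) * liftF F (Rtilt F q N) * z1 S (-1 - a) * liftF F (Rc F q N)
    - z2 S (1 - b) * liftF F (Rct F q N) * z1 S (1 - a) * liftF F (Rtil F q N)
    + z2 S (2 - b) * liftF F (Rct F q N) * z1 S (-a) * liftF F (Rc F q N)

def SfreeA (F : Type) [Field F] (N : ℕ) (r : ℕ) :
    Matrix (Fin N) (Fin N) (FreeAlgebra F (ℕ × Fin N × Fin N)) :=
  Matrix.of fun i j => FreeAlgebra.ι F (r, i, j)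

/-- Defining relations: only the affine reflection equation (coefficientwise). -/
inductive Rel9 (F : Type) [Field F] (q : F) (N : ℕ) :
    FreeAlgebra F (ℕ × Fin N × Fin N) → FreeAlgebra F (ℕ × Fin N × Fin N) → Prop
  | refl (a b : ℤ) (p r : Fin N × Fin N) :
      Rel9 F q N (affLHS F q (SfreeA F N) a b p r) (affRHS F q (SfreeA F N) a b p r)

abbrev Alg9 (F : Type) [Field F] (q : F) (N : ℕ) := RingQuot (Rel9 F q N)

def s9 (F : Type) [Field F] (q : F) (N : ℕ) (r : ℕ) (i j : Fin N) : Alg9 F q N :=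
  RingQuot.mkAlgHom F (Rel9 F q N) (FreeAlgebra.ι F (r, i, j))

/-- Defining relations of the presented twisted q-Yangian (orthogonal case). -/
inductive AORel (F : Type) [Field F] (q : F) (N : ℕ) :
    FreeAlgebra F (ℕ × Fin N × Fin N) → FreeAlgebra F (ℕ × Fin N × Fin N) → Prop
  | tri (i j : Fin N) (h : i < j) : AORel F q N (FreeAlgebra.ι F (0, i, j)) 0
  | diag (i : Fin N) : AORel F q N (FreeAlgebra.ι F (0, i, i)) 1
  | refl (a b : ℤ) (p r : Fin N × Fin N) :
      AORel F q N (affLHS F q (SfreeA F N) a b p r) (affRHS F q (SfreeA F N) a b p r)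

abbrev AlgAO (F : Type) [Field F] (q : F) (N : ℕ) := RingQuot (AORel F q N)

def sAO (F : Type) [Field F] (q : F) (N : ℕ) (r : ℕ) (i j : Fin N) : AlgAO F q N :=
  RingQuot.mkAlgHom F (AORel F q N) (FreeAlgebra.ι F (r, i, j))

/-- Lexicographic (non-strict) comparison of triples. -/
def tripLe (x y : ℕ × ℕ × ℕ) : Prop :=
  x.1 < y.1 ∨ (x.1 = y.1 ∧ (x.2.1 < y.2.1 ∨ (x.2.1 = y.2.1 ∧ x.2.2 ≤ y.2.2)))

/-- A list of generator indices `(r,i,j)` is ordered if it is weakly increasing with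
respect to the lexicographic order on `(r,i,j)`. -/
def sortedGens {N : ℕ} (l : List (ℕ × Fin N × Fin N)) : Prop :=
  l.Chain' fun x y => tripLe (x.1, x.2.1.val, x.2.2.val) (y.1, y.2.1.val, y.2.2.val)

/-! The quantum affine algebra `U_q(ĝl_N)` by its RTT presentation, coefficientwise. -/

abbrev AffGen (N : ℕ) := (ℕ × Fin N × Fin N) ⊕ (ℕ × Fin N × Fin N)

def TfA (F : Type) [Field F] (N : ℕ) (r : ℕ) :
    Matrix (Fin N) (Fin N) (FreeAlgebra F (AffGen N)) :=
  Matrix.of fun i j => FreeAlgebra.ι F (Sum.inl (r, i, j))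

def TbfA (F : Type) [Field F] (N : ℕ) (r : ℕ) :
    Matrix (Fin N) (Fin N) (FreeAlgebra F (AffGen N)) :=
  Matrix.of fun i j => FreeAlgebra.ι F (Sum.inr (r, i, j))

/-- Coefficient of `u^a v^b` in `R(u,v) X₁ Y₂` with prescribed coefficient extractions. -/
def affRttL (F : Type) [Field F] (q : F) {N : ℕ} {A : Type} [Ring A] [Algebra F A]
    (X Y : ℕ → Matrix (Fin N) (Fin N) A) (a b a' b' : ℤ) :
    Matrix (Fin N × Fin N) (Fin N × Fin N) A :=
  liftF F (Rtil F q N) * z1 X a * z2 Y b - liftF F (Rc F q N) * z1 X a' * z2 Y b'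

def affRttR (F : Type) [Field F] (q : F) {N : ℕ} {A : Type} [Ring A] [Algebra F A]
    (X Y : ℕ → Matrix (Fin N) (Fin N) A) (a b a' b' : ℤ) :
    Matrix (Fin N × Fin N) (Fin N × Fin N) A :=
  z2 Y b * z1 X a * liftF F (Rtil F q N) - z2 Y b' * z1 X a' * liftF F (Rc F q N)

inductive AffGlRel (F : Type) [Field F] (q : F) (N : ℕ) :
    FreeAlgebra F (AffGen N) → FreeAlgebra F (AffGen N) → Prop
  | t0_tri (i j : Fin N) (h : i < j) : AffGlRel F q N (TfA F N 0 i j) 0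
  | tb0_tri (i j : Fin N) (h : j < i) : AffGlRel F q N (TbfA F N 0 i j) 0
  | t_tb (i : Fin N) : AffGlRel F q N (TfA F N 0 i i * TbfA F N 0 i i) 1
  | tb_t (i : Fin N) : AffGlRel F q N (TbfA F N 0 i i * TfA F N 0 i i) 1
  | rtt (a b : ℤ) (p r : Fin N × Fin N) :
      AffGlRel F q N
        (affRttL F q (TfA F N) (TfA F N) (1 - a) (-b) (-a) (1 - b) p r)
        (affRttR F q (TfA F N) (TfA F N) (1 - a) (-b) (-a) (1 - b) p r)
  | rtbtb (a b : ℤ) (p r : Fin N × Fin N) :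
      AffGlRel F q N
        (affRttL F q (TbfA F N) (TbfA F N) (a - 1) b a (b - 1) p r)
        (affRttR F q (TbfA F N) (TbfA F N) (a - 1) b a (b - 1) p r)
  | rtbt (a b : ℤ) (p r : Fin N × Fin N) :
      AffGlRel F q N
        (affRttL F q (TbfA F N) (TfA F N) (a - 1) (-b) a (1 - b) p r)
        (affRttR F q (TbfA F N) (TfA F N) (a - 1) (-b) a (1 - b) p r)

/-- The quantum affine algebra `U_q(ĝl_N)`. -/
abbrev UqAff (F : Type) [Field F] (q : F) (N : ℕ) := RingQuot (AffGlRel F q N)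

def tA (F : Type) [Field F] (q : F) (N : ℕ) (r : ℕ) (i j : Fin N) : UqAff F q N :=
  RingQuot.mkAlgHom F (AffGlRel F q N) (FreeAlgebra.ι F (Sum.inl (r, i, j)))

def tbA (F : Type) [Field F] (q : F) (N : ℕ) (r : ℕ) (i j : Fin N) : UqAff F q N :=
  RingQuot.mkAlgHom F (AffGlRel F q N) (FreeAlgebra.ι F (Sum.inr (r, i, j)))

/-- Coefficient of `u^{-r}` in `s_ij(u) = Σ_a t_ia(u) t̄_ja(u⁻¹)`. -/
def Scoef (F : Type) [Field F] (q : F) (N : ℕ) (r : ℕ) (i j : Fin N) : UqAff F q N :=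
  ∑ a : Fin N, ∑ p ∈ Finset.range (r + 1), tA F q N p i a * tbA F q N (r - p) j a

/-- The twisted q-Yangian `Y^tw_q(o_N)` as a subalgebra of `U_q(ĝl_N)`. -/
def YtwO (F : Type) [Field F] (q : F) (N : ℕ) : Subalgebra F (UqAff F q N) :=
  Algebra.adjoin F {x | ∃ r i j, x = Scoef F q N r i j}

/-- Coefficient of `u^{-r}` in `s_ij(u)`, the `(i,j)` entry of `S(u) = T(u) G T̄(u⁻¹)ᵗ`
in the symplectic case. -/
def ScoefSp (F : Type) [Field F] (q : F) (n : ℕ) (r : ℕ) (i j : Fin (2 * n)) :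
    UqAff F q (2 * n) :=
  ∑ a : Fin n, ∑ p ∈ Finset.range (r + 1),
    (algebraMap F _ q * (tA F q (2 * n) p i (fe n a) * tbA F q (2 * n) (r - p) j (fo n a))
      - tA F q (2 * n) p i (fo n a) * tbA F q (2 * n) (r - p) j (fe n a))

/-- The twisted q-Yangian `Y^tw_q(sp_2n)` as a subalgebra of `U_q(ĝl_2n)`,
with a prescribed family of inverses of `s^{(0)}_{ii'}`. -/
def YtwSp (F : Type) [Field F] (q : F) (n : ℕ) (inv : Fin n → UqAff F q (2 * n)) :
    Subalgebra F (UqAff F q (2 * n)) :=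
  Algebra.adjoin F ({x | ∃ r i j, x = ScoefSp F q n r i j} ∪ Set.range inv)

abbrev ASpGen (n : ℕ) := (ℕ × Fin (2 * n) × Fin (2 * n)) ⊕ Fin n

def SfreeASp (F : Type) [Field F] (n : ℕ) (r : ℕ) :
    Matrix (Fin (2 * n)) (Fin (2 * n)) (FreeAlgebra F (ASpGen n)) :=
  Matrix.of fun i j => FreeAlgebra.ι F (Sum.inl (r, i, j))

/-- Defining relations of the presented twisted q-Yangian (symplectic case). -/
inductive ASpRel (F : Type) [Field F] (q : F) (n : ℕ) :
    FreeAlgebra F (ASpGen n) → FreeAlgebra F (ASpGen n) → Prop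
  | tri (i j : Fin (2 * n)) (h : i < j) (h' : ¬(i.val % 2 = 0 ∧ j.val = i.val + 1)) :
      ASpRel F q n (FreeAlgebra.ι F (Sum.inl (0, i, j))) 0
  | quad (k : Fin n) :
      ASpRel F q n
        (FreeAlgebra.ι F (Sum.inl (0, fo n k, fo n k)) *
          FreeAlgebra.ι F (Sum.inl (0, fe n k, fe n k)))
        (algebraMap F _ (q ^ 2) *
            (FreeAlgebra.ι F (Sum.inl (0, fo n k, fe n k)) *
              FreeAlgebra.ι F (Sum.inl (0, fe n k, fo n k)))
          + algebraMap F _ (q ^ 3))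
  | invR (k : Fin n) :
      ASpRel F q n
        (FreeAlgebra.ι F (Sum.inl (0, fe n k, fo n k)) * FreeAlgebra.ι F (Sum.inr k)) 1
  | invL (k : Fin n) :
      ASpRel F q n
        (FreeAlgebra.ι F (Sum.inr k) * FreeAlgebra.ι F (Sum.inl (0, fe n k, fo n k))) 1
  | refl (a b : ℤ) (p r : Fin (2 * n) × Fin (2 * n)) :
      ASpRel F q n (affLHS F q (SfreeASp F n) a b p r) (affRHS F q (SfreeASp F n) a b p r)

abbrev AlgASp (F : Type) [Field F] (q : F) (n : ℕ) := RingQuot (ASpRel F q n)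

def sASp (F : Type) [Field F] (q : F) (n : ℕ) (r : ℕ) (i j : Fin (2 * n)) : AlgASp F q n :=
  RingQuot.mkAlgHom F (ASpRel F q n) (FreeAlgebra.ι F (Sum.inl (r, i, j)))

def sInvASp (F : Type) [Field F] (q : F) (n : ℕ) (k : Fin n) : AlgASp F q n :=
  RingQuot.mkAlgHom F (ASpRel F q n) (FreeAlgebra.ι F (Sum.inr k))

/-! q-antisymmetrizer and Sklyanin/quantum determinant machinery. -/

/-- The trigonometric R-matrix `R(u,v)`. -/
def Rtrig (F : Type) [Field F] (q : F) (N : ℕ) (u v : F) :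
    Matrix (Fin N × Fin N) (Fin N × Fin N) F := Matrix.of fun p r =>
  (if p = r then (if p.1 = p.2 then q⁻¹ * u - q * v else u - v) else 0)
  + (if p.1 = r.2 ∧ p.2 = r.1 ∧ p.1 ≠ p.2 then
      (q⁻¹ - q) * (if p.2 < p.1 then u else v) else 0)

/-- An operator on `ℂ^N ⊗ ℂ^N` acting in the `i`-th and `j`-th factors of `(ℂ^N)^{⊗ r}`. -/
def big2 (F : Type) [Field F] {N r : ℕ} (i j : Fin r)
    (M : Matrix (Fin N × Fin N) (Fin N × Fin N) F) :
    Matrix (Fin r → Fin N) (Fin r → Fin N) F :=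
  Matrix.of fun f g =>
    if ∀ k, k ≠ i → k ≠ j → f k = g k then M (f i, f j) (g i, g j) else 0

/-- The list of the pairs `(i,j)`, `i < j`, in lexicographic order. -/
def pairsLex (r : ℕ) : List (Fin r × Fin r) :=
  (List.finRange r).flatMap fun i =>
    ((List.finRange r).filter fun j => i < j).map fun j => (i, j)

/-- The number of inversions (the Coxeter length) of a permutation. -/
def invCount {r : ℕ} (σ : Equiv.Perm (Fin r)) : ℕ :=
  (Finset.univ.filter fun p : Fin r × Fin r => p.1 < p.2 ∧ σ p.2 < σ p.1).card

/-- The q-permutation operator `P^q` on `ℂ^N ⊗ ℂ^N`. -/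
def PqSmall (F : Type) [Field F] (q : F) (N : ℕ) :
    Matrix (Fin N × Fin N) (Fin N × Fin N) F := Matrix.of fun p r =>
  if r.1 = p.2 ∧ r.2 = p.1 then (if p.1 = p.2 then 1 else if p.2 < p.1 then q else q⁻¹)
  else 0

/-- The hypothesis that `Pq` is the extension of the q-permutation operators along
reduced decompositions: `P^q_{σ s_i} = P^q_σ P^q_{s_i}` whenever the length grows. -/
def PqExt (F : Type) [Field F] (q : F) (N r : ℕ)
    (Pq : Equiv.Perm (Fin r) → Matrix (Fin r → Fin N) (Fin r → Fin N) F) : Prop :=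
  Pq 1 = 1 ∧
    ∀ (σ : Equiv.Perm (Fin r)) (i : ℕ) (h : i + 1 < r),
      invCount (σ * Equiv.swap ⟨i, Nat.lt_of_succ_lt h⟩ ⟨i + 1, h⟩) = invCount σ + 1 →
        Pq (σ * Equiv.swap ⟨i, Nat.lt_of_succ_lt h⟩ ⟨i + 1, h⟩) =
          Pq σ * big2 F ⟨i, Nat.lt_of_succ_lt h⟩ ⟨i + 1, h⟩ (PqSmall F q N)

/-- The q-antisymmetrizer `A^q_r = Σ_σ sgn(σ) P^q_σ`. -/
def AqM (F : Type) [Field F] {N r : ℕ}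
    (Pq : Equiv.Perm (Fin r) → Matrix (Fin r → Fin N) (Fin r → Fin N) F) :
    Matrix (Fin r → Fin N) (Fin r → Fin N) F :=
  ∑ σ : Equiv.Perm (Fin r), ((Equiv.Perm.sign σ : ℤ) : F) • Pq σ

/-- A matrix acting in the `k`-th factor of `(ℂ^N)^{⊗ N}`, with entries in `A`. -/
def ampAt {A : Type} [Ring A] {N : ℕ} (k : Fin N) (M : Matrix (Fin N) (Fin N) A) :
    Matrix (Fin N → Fin N) (Fin N → Fin N) A :=
  Matrix.of fun f g => if ∀ l, l ≠ k → f l = g l then M (f k) (g k) else 0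

/-- A scalar two-site operator viewed over `A`, acting at sites `i`, `j`. -/
def big2A (F : Type) [Field F] {A : Type} [Ring A] [Algebra F A] {N : ℕ} (i j : Fin N)
    (M : Matrix (Fin N × Fin N) (Fin N × Fin N) F) :
    Matrix (Fin N → Fin N) (Fin N → Fin N) A :=
  (big2 F i j M).map (algebraMap F A)

/-- Coefficient of `u^m` in a product of formal series, each of which is supported in
degrees `≤ 1`; the series are given by their coefficient functions `ℤ → M`. -/
def seriesProdCoeff {M : Type} [Ring M] : List (ℤ → M) → ℤ → M
  | [], m => if m = 0 then 1 else 0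
  | c :: t, m => ∑ k ∈ Finset.Icc (m - t.length) 1, c k * seriesProdCoeff t (m - k)

/-! Series factors entering the Sklyanin determinant. -/

/-- The matrix `S^{(r)}` of the coefficients of `S(u)` (orthogonal case). -/
def SmatA (F : Type) [Field F] (q : F) (N : ℕ) (r : ℕ) :
    Matrix (Fin N) (Fin N) (UqAff F q N) :=
  Matrix.of fun i j => Scoef F q N r i j

/-- The series `S_k(q^{-2k+2} u)` acting at site `k` (0-based `k`), coefficientwise. -/
def SfacO (F : Type) [Field F] (q : F) (N : ℕ) (k : Fin N) (m : ℤ) :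
    Matrix (Fin N → Fin N) (Fin N → Fin N) (UqAff F q N) :=
  if m ≤ 0 then q ^ (2 * (k.val : ℤ) * (-m)) • ampAt k (SmatA F q N (-m).toNat) else 0

/-- The series `R_{ij}ᵗ((q^{-2i+2}u)⁻¹, q^{-2j+2}u)` (0-based `i`, `j`), coefficientwise. -/
def RtfacO (F : Type) [Field F] (q : F) (N : ℕ) (i j : Fin N) (m : ℤ) :
    Matrix (Fin N → Fin N) (Fin N → Fin N) (UqAff F q N) :=
  if m = -1 then q ^ (2 * (i.val : ℤ)) • big2A F i j (Rtilt F q N)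
  else if m = 1 then (-(q ^ (-2 * (j.val : ℤ)))) • big2A F i j (Rct F q N)
  else 0

/-- The ordered list of factors `S₁(u) R₁₂ᵗ ⋯ R₁Nᵗ S₂(q⁻²u) ⋯ S_N(q^{-2N+2}u)`. -/
def sdetFacsO (F : Type) [Field F] (q : F) (N : ℕ) :
    List (ℤ → Matrix (Fin N → Fin N) (Fin N → Fin N) (UqAff F q N)) :=
  (List.finRange N).flatMap fun i =>
    SfacO F q N i :: (((List.finRange N).filter fun j => i < j).map fun j => RtfacO F q N i j)

/-- The matrix `S^{(r)}` of the coefficients of `S(u)` (symplectic case). -/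
def SmatASp (F : Type) [Field F] (q : F) (n : ℕ) (r : ℕ) :
    Matrix (Fin (2 * n)) (Fin (2 * n)) (UqAff F q (2 * n)) :=
  Matrix.of fun i j => ScoefSp F q n r i j

def SfacSp (F : Type) [Field F] (q : F) (n : ℕ) (k : Fin (2 * n)) (m : ℤ) :
    Matrix (Fin (2 * n) → Fin (2 * n)) (Fin (2 * n) → Fin (2 * n)) (UqAff F q (2 * n)) :=
  if m ≤ 0 then q ^ (2 * (k.val : ℤ) * (-m)) • ampAt k (SmatASp F q n (-m).toNat) else 0

def sdetFacsSp (F : Type) [Field F] (q : F) (n : ℕ) :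
    List (ℤ → Matrix (Fin (2 * n) → Fin (2 * n)) (Fin (2 * n) → Fin (2 * n))
      (UqAff F q (2 * n))) :=
  (List.finRange (2 * n)).flatMap fun i =>
    SfacSp F q n i ::
      (((List.finRange (2 * n)).filter fun j => i < j).map fun j => RtfacO F q (2 * n) i j)

/-- Coefficientwise quantum determinant `qdet T(u)`:
the coefficient of `u^m` (nonzero only for `m ≤ 0`). -/
def qdetTc (F : Type) [Field F] (q : F) (N : ℕ) (m : ℤ) : UqAff F q N :=
  if m ≤ 0 then
    ∑ σ : Equiv.Perm (Fin N), ∑ rv ∈ Finset.Nat.antidiagonalTuple N (-m).toNat,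
      (((-q)⁻¹ ^ invCount σ) * ∏ k : Fin N, q ^ (2 * (k.val : ℤ) * (rv k : ℤ))) •
        ((List.finRange N).map fun k => tA F q N (rv k) (σ k) k).prod
  else 0

/-- Coefficientwise quantum determinant `qdet T̄(q^{2N-2} u⁻¹)`:
the coefficient of `u^m` (nonzero only for `m ≤ 0`). -/
def qdetTbc (F : Type) [Field F] (q : F) (N : ℕ) (m : ℤ) : UqAff F q N :=
  if m ≤ 0 then
    ∑ σ : Equiv.Perm (Fin N), ∑ rv ∈ Finset.Nat.antidiagonalTuple N (-m).toNat,
      (((-q)⁻¹ ^ invCount σ) *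
          ∏ k : Fin N, q ^ ((2 * (N : ℤ) - 2 - 2 * (k.val : ℤ)) * (rv k : ℤ))) •
        ((List.finRange N).map fun k => tbA F q N (rv k) (σ k) k).prod
  else 0

/-- The linear factor `q^{2i-2}u⁻¹ - q^{-2j+2}u` of `γ_N(u)` (0-based `i`, `j`),
viewed as an `A`-valued series. -/
def gamFac (F : Type) [Field F] (q : F) (N : ℕ) (p : Fin N × Fin N) (m : ℤ) : UqAff F q N :=
  if m = -1 then algebraMap F _ (q ^ (2 * (p.1.val : ℤ)))
  else if m = 1 then algebraMap F _ (-(q ^ (-2 * (p.2.val : ℤ)))) else 0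

/-- The list of series whose product is `γ_N(u) qdet T(u) qdet T̄(q^{2N-2}u⁻¹)`
in the orthogonal case. -/
def rhsO (F : Type) [Field F] (q : F) (N : ℕ) : List (ℤ → UqAff F q N) :=
  ((pairsLex N).map fun p => gamFac F q N p) ++ [qdetTc F q N, qdetTbc F q N]

/-! ### Entries of the reflection equation -/

/-- `q` to the power of the truth value of `P`. -/
def qIf {F : Type} [Field F] (q : F) (P : Prop) [Decidable P] : F := if P then q else 1

/-- `q - q⁻¹` times the truth value of `P`. -/
def lamIf {F : Type} [Field F] (q : F) (P : Prop) [Decidable P] : F := if P then q - q⁻¹ else 0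

theorem Rc_apply (F : Type) [Field F] (q : F) {N : ℕ} (i j k l : Fin N) :
    Rc F q N (i, j) (k, l) =
      (if i = k ∧ j = l then qIf q (i = j) else 0)
        + (if i = l ∧ j = k then lamIf q (i < j) else 0) := by
  simp only [Rc, qIf, lamIf, Matrix.of_apply, Prod.mk.injEq]
  congr 1
  split_ifs <;> first | rfl | tauto

section Entries

variable (F : Type) [Field F] (q : F) {N : ℕ} {A : Type} [Ring A] [Algebra F A]

theorem liftF_Rc_mul_apply (M : Matrix (Fin N × Fin N) (Fin N × Fin N) A) (i j : Fin N)
    (r : Fin N × Fin N) :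
    (liftF F (Rc F q N) * M : Matrix (Fin N × Fin N) (Fin N × Fin N) A) (i, j) r
      = qIf q (i = j) • M (i, j) r + lamIf q (i < j) • M (j, i) r := by
  simp only [Matrix.mul_apply, liftF, Matrix.map_apply, Fintype.sum_prod_type, Rc_apply, add_smul,
    Finset.sum_add_distrib, ← Algebra.smul_def, ite_smul, zero_smul]
  congr 1
  · simp [ite_and]
  · rw [Finset.sum_comm]
    simp [ite_and]

theorem mul_liftF_Rc_apply (M : Matrix (Fin N × Fin N) (Fin N × Fin N) A) (a b : Fin N)
    (p : Fin N × Fin N) :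
    (M * liftF F (Rc F q N) : Matrix (Fin N × Fin N) (Fin N × Fin N) A) p (a, b)
      = qIf q (a = b) • M p (a, b) + lamIf q (b < a) • M p (b, a) := by
  simp only [Matrix.mul_apply, liftF, Matrix.map_apply, Fintype.sum_prod_type, Rc_apply, add_smul,
    Finset.sum_add_distrib, ← Algebra.commutes, ← Algebra.smul_def, ite_smul, zero_smul]
  congr 1
  · simp [ite_and]
  · simp [ite_and]

theorem Rct_apply (i j k l : Fin N) :
    Rct F q N (i, j) (k, l) =
      (if i = k ∧ j = l then qIf q (k = j) else 0)
        + (if k = l ∧ j = i then lamIf q (k < j) else 0) := by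
  simp only [Rct, Matrix.of_apply, Rc_apply]
  congr 1
  simp only [eq_comm]

theorem amp1_mul_Rct_mul_amp2_apply (S : Matrix (Fin N) (Fin N) A) (i j a b : Fin N) :
    (amp1 S * liftF F (Rct F q N) * amp2 S : Matrix (Fin N × Fin N) (Fin N × Fin N) A)
        (i, j) (a, b)
      = qIf q (j = a) • (S i a * S j b) + lamIf q (a < j) • (S i j * S a b) := by
  have h (d : Fin N) :
      (amp1 S * liftF F (Rct F q N) : Matrix (Fin N × Fin N) (Fin N × Fin N) A) (i, j) (a, d)
      = (if j = d then qIf q (j = a) • S i a else 0)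
        + (if a = d then lamIf q (a < j) • S i j else 0) := by
    simp only [Matrix.mul_apply, amp1, liftF, Matrix.map_apply, Matrix.of_apply,
      Fintype.sum_prod_type, Rct_apply, add_smul,
      ← Algebra.commutes, ← Algebra.smul_def, ite_smul, zero_smul, smul_ite, smul_zero]
    by_cases hd : a = d <;> simp [ite_and, eq_comm, Finset.sum_add_distrib, hd]
  rw [Matrix.mul_apply, Fintype.sum_prod_type, Finset.sum_eq_single a]
  · simp [h, amp2, add_mul, Finset.sum_add_distrib, ite_mul]
  · intro m _ hm
    simp [amp2, hm]
  · simp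

theorem amp2_mul_Rct_mul_amp1_apply (S : Matrix (Fin N) (Fin N) A) (i j a b : Fin N) :
    (amp2 S * liftF F (Rct F q N) * amp1 S : Matrix (Fin N × Fin N) (Fin N × Fin N) A)
        (i, j) (a, b)
      = qIf q (i = b) • (S j b * S i a) + lamIf q (b < i) • (S j i * S b a) := by
  have h (m : Fin N) :
      (amp2 S * liftF F (Rct F q N) : Matrix (Fin N × Fin N) (Fin N × Fin N) A) (i, j) (m, b)
      = (if i = m then qIf q (i = b) • S j b else 0)
        + (if m = b then lamIf q (b < i) • S j i else 0) := by
    simp only [Matrix.mul_apply, amp2, liftF, Matrix.map_apply, Matrix.of_apply,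
      Fintype.sum_prod_type, Rct_apply, add_smul,
      ← Algebra.commutes, ← Algebra.smul_def, ite_smul, zero_smul, smul_ite, smul_zero]
    by_cases hi : i = m <;> obtain rfl | hb := eq_or_ne m b <;>
      simp [ite_and, *, Finset.sum_add_distrib]
  rw [Matrix.mul_apply, Fintype.sum_prod_type_right, Finset.sum_eq_single b]
  · simp [h, amp1, add_mul, Finset.sum_add_distrib, ite_mul]
  · intro m _ hm
    simp [amp1, hm]
  · simp

theorem reflLHS_apply (S : Matrix (Fin N) (Fin N) A) (i j a b : Fin N) :
    reflLHS F q S (i, j) (a, b)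
      = qIf q (i = j) • (qIf q (j = a) • (S i a * S j b) + lamIf q (a < j) • (S i j * S a b))
        + lamIf q (i < j) •
          (qIf q (i = a) • (S j a * S i b) + lamIf q (a < i) • (S j i * S a b)) := by
  simp only [reflLHS, Matrix.mul_assoc]
  rw [liftF_Rc_mul_apply]
  simp only [← Matrix.mul_assoc, amp1_mul_Rct_mul_amp2_apply]

theorem reflRHS_apply (S : Matrix (Fin N) (Fin N) A) (i j a b : Fin N) :
    reflRHS F q S (i, j) (a, b)
      = qIf q (a = b) • (qIf q (i = b) • (S j b * S i a) + lamIf q (b < i) • (S j i * S b a))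
        + lamIf q (b < a) •
          (qIf q (i = a) • (S j a * S i b) + lamIf q (a < i) • (S j i * S a b)) := by
  rw [reflRHS, mul_liftF_Rc_apply]
  simp only [amp2_mul_Rct_mul_amp1_apply]

end Entries

/-! ### Products of submodules -/

section Closed

variable {F : Type} [Field F] {B : Type} [Ring B] [Algebra F B]

open Submodule

/-- The ordered product of unital multiplicatively closed subspaces which can be reordered
is itself unital and multiplicatively closed. -/
theorem Submodule.one_le_and_mul_le_list_prod (l : List (Submodule F B))
    (h : ∀ R ∈ l, 1 ≤ R ∧ R * R ≤ R) (hl : l.Pairwise fun R S => S * R ≤ R * S) :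
    1 ≤ l.prod ∧ l.prod * l.prod ≤ l.prod ∧ ∀ R ∈ l, R ≤ l.prod := by
  induction l with
  | nil => simp
  | cons R l ih =>
    rw [List.pairwise_cons] at hl
    obtain ⟨h1, h2, h3⟩ := ih (fun S hS => h S (List.mem_cons_of_mem _ hS)) hl.2
    obtain ⟨hR1, hR2⟩ := h R List.mem_cons_self
    have hcomm : l.prod * R ≤ R * l.prod := by
      have key := hl.1
      clear * - key
      induction l with
      | nil => simp
      | cons S l ih =>
        rw [List.prod_cons]
        calc S * l.prod * R = S * (l.prod * R) := mul_assoc ..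
          _ ≤ S * (R * l.prod) :=
            mul_le_mul_right (ih fun T hT => key T (List.mem_cons_of_mem _ hT)) _
          _ = S * R * l.prod := (mul_assoc ..).symm
          _ ≤ R * S * l.prod := mul_le_mul_left (key S List.mem_cons_self) _
          _ = R * (S * l.prod) := mul_assoc ..
    have hle : R ≤ R * l.prod := by simpa using mul_le_mul_right h1 R
    have hle' : l.prod ≤ R * l.prod := by simpa using mul_le_mul_left hR1 l.prod
    rw [List.prod_cons]
    refine ⟨hR1.trans hle, ?_, ?_⟩
    · calc R * l.prod * (R * l.prod) = R * (l.prod * R) * l.prod := by simp only [mul_assoc]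
        _ ≤ R * (R * l.prod) * l.prod := mul_le_mul_left (mul_le_mul_right hcomm _) _
        _ = R * R * (l.prod * l.prod) := by simp only [mul_assoc]
        _ ≤ R * l.prod := mul_le_mul' hR2 h2
    · intro S hS
      rcases List.mem_cons.1 hS with rfl | hS
      · exact hle
      · exact (h3 S hS).trans hle'

theorem Submodule.adjoin_le_of_mul_le {s : Set B} {P : Submodule F B} (h1 : 1 ≤ P)
    (h2 : P * P ≤ P) (hs : s ⊆ P) : Subalgebra.toSubmodule (Algebra.adjoin F s) ≤ P := by
  let P' : Subalgebra F B := P.toSubalgebra (one_le.1 h1) fun x y hx hy => h2 (mul_mem_mul hx hy)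
  exact fun x hx => Algebra.adjoin_le (S := P') hs hx

theorem Submodule.one_le_adjoin (s : Set B) :
    1 ≤ Subalgebra.toSubmodule (Algebra.adjoin F s) :=
  one_le.2 (one_mem (Algebra.adjoin F s))

theorem Submodule.adjoin_mul_self_le (s : Set B) :
    Subalgebra.toSubmodule (Algebra.adjoin F s) * Subalgebra.toSubmodule (Algebra.adjoin F s)
      ≤ Subalgebra.toSubmodule (Algebra.adjoin F s) :=
  mul_le.2 fun _ hx _ hy => mul_mem (S := Subalgebra F B) hx hy

/-- Reordering of two sets of generators extends to the generated subalgebras. -/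
theorem Submodule.adjoin_mul_adjoin_le {s t : Set B}
    (h : span F s * span F t ≤ span F t * span F s) :
    Subalgebra.toSubmodule (Algebra.adjoin F s) * Subalgebra.toSubmodule (Algebra.adjoin F t) ≤
      Subalgebra.toSubmodule (Algebra.adjoin F t) *
        Subalgebra.toSubmodule (Algebra.adjoin F s) := by
  set S := Subalgebra.toSubmodule (Algebra.adjoin F s)
  set T := Subalgebra.toSubmodule (Algebra.adjoin F t)
  have hsS : span F s ≤ S := span_le.2 Algebra.subset_adjoin
  have htT : span F t ≤ T := span_le.2 Algebra.subset_adjoin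
  have hS : S * S ≤ S := adjoin_mul_self_le s
  have hT : T * T ≤ T := adjoin_mul_self_le t
  have step : span F s * T ≤ T * span F s := by
    refine mul_le.2 fun x hx y hy => ?_
    induction hy using Algebra.adjoin_induction generalizing x with
    | mem y hy =>
      exact mul_le_mul_left htT _ (h (mul_mem_mul hx (subset_span hy)))
    | algebraMap r =>
      rw [← Algebra.commutes]
      exact mul_mem_mul (Subalgebra.algebraMap_mem (Algebra.adjoin F t) r) hx
    | add y z _ _ hy hz =>
      rw [mul_add]
      exact add_mem (hy x hx) (hz x hx)
    | mul y z _ _ hy hz =>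
      have h0 : span F s * span F {z} ≤ T * span F s := by
        refine mul_le.2 fun a ha b hb => ?_
        obtain ⟨c, rfl⟩ := mem_span_singleton.1 hb
        rw [mul_smul_comm]
        exact smul_mem _ _ (hz a ha)
      have h1 : T * span F s * span F {z} ≤ T * span F s := by
        rw [mul_assoc]
        refine (mul_le_mul_right h0 T).trans ?_
        rw [← mul_assoc]
        exact mul_le_mul_left hT _
      rw [← mul_assoc]
      exact h1 (mul_mem_mul (hy x hx) (mem_span_singleton_self z))
  refine mul_le.2 fun x hx y hy => ?_
  induction hx using Algebra.adjoin_induction generalizing y with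
  | mem x hx => exact mul_le_mul_right hsS _ (step (mul_mem_mul (subset_span hx) hy))
  | algebraMap r =>
    rw [Algebra.commutes]
    exact mul_mem_mul hy (Subalgebra.algebraMap_mem (Algebra.adjoin F s) r)
  | add x z _ _ hx hz =>
    rw [add_mul]
    exact add_mem (hx y hy) (hz y hy)
  | mul x z _ _ hx hz =>
    have h0 : span F {x} * T ≤ T * S := by
      refine mul_le.2 fun a ha b hb => ?_
      obtain ⟨c, rfl⟩ := mem_span_singleton.1 ha
      rw [smul_mul_assoc]
      exact smul_mem _ _ (hx b hb)
    have h1 : span F {x} * (T * S) ≤ T * S := by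
      rw [← mul_assoc]
      refine (mul_le_mul_left h0 S).trans ?_
      rw [mul_assoc]
      exact mul_le_mul_right hS _
    rw [mul_assoc]
    exact h1 (mul_mem_mul (mem_span_singleton_self x) (hz y hy))

/-- A product of spans is contained in the span of the products. -/
theorem Submodule.list_prod_span_range_le {ι E : Type} [DecidableEq ι] [Nonempty E]
    (f : ι → E → B) (l : List ι) (hl : l.Nodup) :
    (l.map fun p => span F (Set.range (f p))).prod ≤
      span F (Set.range fun κ : ι → E => (l.map fun p => f p (κ p)).prod) := by
  induction l with
  | nil =>
    rw [List.map_nil, List.prod_nil, one_le]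
    exact subset_span ⟨fun _ => Classical.arbitrary E, rfl⟩
  | cons a l ih =>
    rw [List.nodup_cons] at hl
    rw [List.map_cons, List.prod_cons]
    refine (mul_le_mul_right (ih hl.2) _).trans ?_
    rw [span_mul_span, span_le]
    rintro _ ⟨_, ⟨e, rfl⟩, _, ⟨κ, rfl⟩, rfl⟩
    refine subset_span ⟨Function.update κ a e, ?_⟩
    simp only [List.map_cons, List.prod_cons, Function.update_self]
    congr 2
    refine List.map_congr_left fun p hp => ?_
    rw [Function.update_of_ne]
    rintro rfl
    exact hl.1 hp

end Closed

/-! ### Commutation up to a nonzero scalar -/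

/-- `x` and `y` commute up to a nonzero scalar. -/
def QCommute (F : Type) [Field F] {B : Type} [Ring B] [Algebra F B] (x y : B) : Prop :=
  ∃ c : F, c ≠ 0 ∧ x * y = c • (y * x)

namespace QCommute

variable {F : Type} [Field F] {B : Type} [Ring B] [Algebra F B] {x y z : B}

theorem of_smul_eq {a b : F} (ha : a ≠ 0) (hb : b ≠ 0) (h : a • (x * y) = b • (y * x)) :
    QCommute F x y :=
  ⟨a⁻¹ * b, mul_ne_zero (inv_ne_zero ha) hb, by rw [mul_smul, ← h, inv_smul_smul₀ ha]⟩

theorem refl (x : B) : QCommute F x x := ⟨1, one_ne_zero, by simp⟩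

theorem symm (h : QCommute F x y) : QCommute F y x := by
  obtain ⟨c, hc, h⟩ := h
  exact ⟨c⁻¹, inv_ne_zero hc, by rw [h, inv_smul_smul₀ hc]⟩

theorem zero_right (x : B) : QCommute F x 0 := ⟨1, one_ne_zero, by simp⟩

theorem one_right (x : B) : QCommute F x 1 := ⟨1, one_ne_zero, by simp⟩

theorem mul_right (hy : QCommute F x y) (hz : QCommute F x z) : QCommute F x (y * z) := by
  obtain ⟨c, hc, h⟩ := hy
  obtain ⟨d, hd, h'⟩ := hz
  refine ⟨c * d, mul_ne_zero hc hd, ?_⟩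
  rw [← mul_assoc, h, smul_mul_assoc, mul_assoc, h', mul_smul_comm, smul_smul, ← mul_assoc]

theorem pow_right (h : QCommute F x y) (m : ℕ) : QCommute F x (y ^ m) := by
  induction m with
  | zero => simpa using one_right x
  | succ m ih => exact pow_succ y m ▸ ih.mul_right h

theorem pow_left (h : QCommute F x y) (m : ℕ) : QCommute F (x ^ m) y :=
  (h.symm.pow_right m).symm

theorem inverse_right (h : QCommute F x y) (h1 : y * z = 1) (h2 : z * y = 1) :
    QCommute F x z := by
  obtain ⟨c, hc, h⟩ := h.symm
  refine ⟨c, hc, ?_⟩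
  calc x * z = z * (y * x) * z := by rw [← mul_assoc, h2, one_mul]
    _ = c • (z * x * (y * z)) := by
      rw [h, mul_smul_comm, smul_mul_assoc]
      simp only [mul_assoc]
    _ = c • (z * x) := by rw [h1, mul_one]

theorem span_mul_span_le {s t : Set B} (h : ∀ x ∈ s, ∀ y ∈ t, QCommute F x y) :
    Submodule.span F s * Submodule.span F t ≤ Submodule.span F t * Submodule.span F s := by
  rw [Submodule.span_mul_span, Submodule.span_le]
  rintro _ ⟨x, hx, y, hy, rfl⟩
  obtain ⟨c, -, h⟩ := h x hx y hy
  change x * y ∈ _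
  rw [h]
  exact Submodule.smul_mem _ _
    (Submodule.mul_mem_mul (Submodule.subset_span hy) (Submodule.subset_span hx))

end QCommute

section Powers

variable (F : Type) [Field F] {B : Type} [Ring B] [Algebra F B]

/-- The span of the powers of `x`. -/
def powSpan (x : B) : Submodule F B := Submodule.span F (Set.range fun m : ℕ => x ^ m)

/-- The integer powers of `c`, where `d` plays the role of the inverse of `c`. -/
def zpowPair (c d : B) (z : ℤ) : B := if 0 ≤ z then c ^ z.toNat else d ^ (-z).toNat

/-- The span of the integer powers of `c`, where `d` plays the role of the inverse of `c`. -/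
def zpowSpan (c d : B) : Submodule F B := Submodule.span F (Set.range (zpowPair c d))

variable {F} {x y c d : B}

theorem self_mem_powSpan (x : B) : x ∈ powSpan F x := Submodule.subset_span ⟨1, pow_one x⟩

theorem powSpan_closed (x : B) : 1 ≤ powSpan F x ∧ powSpan F x * powSpan F x ≤ powSpan F x := by
  constructor
  · exact Submodule.one_le.2 (Submodule.subset_span ⟨0, pow_zero x⟩)
  · rw [powSpan, Submodule.span_mul_span, Submodule.span_le]
    rintro _ ⟨_, ⟨a, rfl⟩, _, ⟨b, rfl⟩, rfl⟩
    exact Submodule.subset_span ⟨a + b, pow_add x a b⟩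

theorem zpowPair_unit (u : Bˣ) (z : ℤ) : zpowPair (u : B) (↑u⁻¹ : B) z = ↑(u ^ z) := by
  unfold zpowPair
  split_ifs with h
  · obtain ⟨m, rfl⟩ := Int.eq_ofNat_of_zero_le h
    simp
  · obtain ⟨m, hm⟩ := Int.eq_ofNat_of_zero_le (show 0 ≤ -z by omega)
    obtain rfl : z = -m := by omega
    simp

theorem zpowSpan_closed (h1 : c * d = 1) (h2 : d * c = 1) :
    1 ≤ zpowSpan F c d ∧ zpowSpan F c d * zpowSpan F c d ≤ zpowSpan F c d := by
  constructor
  · exact Submodule.one_le.2 (Submodule.subset_span ⟨0, by simp [zpowPair]⟩)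
  · rw [zpowSpan, Submodule.span_mul_span, Submodule.span_le]
    rintro _ ⟨_, ⟨a, rfl⟩, _, ⟨b, rfl⟩, rfl⟩
    refine Submodule.subset_span ⟨a + b, ?_⟩
    let u : Bˣ := ⟨c, d, h1, h2⟩
    have h (z : ℤ) : zpowPair c d z = ↑(u ^ z) := zpowPair_unit u z
    simp only [h, zpow_add, Units.val_mul]

theorem mem_zpowSpan_left (c d : B) : c ∈ zpowSpan F c d :=
  Submodule.subset_span ⟨1, by simp [zpowPair]⟩

theorem mem_zpowSpan_right (c d : B) : d ∈ zpowSpan F c d :=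
  Submodule.subset_span ⟨-1, by simp [zpowPair]⟩

theorem QCommute.powSpan_mul_le (h : QCommute F x y) :
    powSpan F x * powSpan F y ≤ powSpan F y * powSpan F x := by
  refine span_mul_span_le ?_
  rintro _ ⟨a, rfl⟩ _ ⟨b, rfl⟩
  exact (h.pow_left a).pow_right b

theorem QCommute.zpowPair_right (hc : QCommute F x c) (hd : QCommute F x d) (z : ℤ) :
    QCommute F x (zpowPair c d z) := by
  unfold zpowPair
  split_ifs
  · exact hc.pow_right _
  · exact hd.pow_right _

theorem QCommute.zpowSpan_mul_le (hc : QCommute F x c) (hd : QCommute F x d) :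
    zpowSpan F c d * powSpan F x ≤ powSpan F x * zpowSpan F c d := by
  refine span_mul_span_le ?_
  rintro _ ⟨a, rfl⟩ _ ⟨b, rfl⟩
  exact ((hc.zpowPair_right hd a).pow_left b).symm

end Powers

/-! ### The homogeneous form of the relations -/

theorem qIf_ne_zero {F : Type} [Field F] {q : F} (hq : q ≠ 0) (P : Prop) [Decidable P] :
    qIf q P ≠ 0 := by
  unfold qIf
  split_ifs
  exacts [hq, one_ne_zero]

theorem sub_lamIf_ne_zero {F : Type} [Field F] {q : F} (hq : q ≠ 0) (P : Prop) [Decidable P] :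
    q - lamIf q P ≠ 0 := by
  unfold lamIf
  split_ifs
  · simpa using hq
  · simpa using hq

/-- The relations of the symplectic algebra `𝒮` with all terms of lower degree omitted, where
`s_ij` has degree `i - j + 1`; here `d` is the family of inverses of the `g_{i i'}`. -/
structure IsGradedSp {F : Type} [Field F] (q : F) (n : ℕ) {B : Type} [Ring B] [Algebra F B]
    (g : Fin (2 * n) → Fin (2 * n) → B) (d : Fin n → B) : Prop where
  tri : ∀ i j, i < j → ¬(i.val % 2 = 0 ∧ j.val = i.val + 1) → g i j = 0
  quad : ∀ k, g (fo n k) (fo n k) * g (fe n k) (fe n k)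
    = q ^ 2 • (g (fo n k) (fe n k) * g (fe n k) (fo n k))
  invR : ∀ k, g (fe n k) (fo n k) * d k = 1
  invL : ∀ k, d k * g (fe n k) (fo n k) = 1
  refl : ∀ i j a b,
    (qIf q (i = j) * qIf q (j = a)) • (g i a * g j b)
        + (lamIf q (i < j) * qIf q (i = a)) • (g j a * g i b)
      = (qIf q (a = b) * qIf q (i = b)) • (g j b * g i a)
        + (lamIf q (b < a) * qIf q (i = a)) • (g j a * g i b)

/-- The row of a generator; the inverse of `s_{i i'}` is placed in row `i`. -/
def genRow (n : ℕ) : SpGen n → Fin (2 * n) := Sum.elim Prod.fst (fe n)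

theorem fe_lt_fo (n : ℕ) (k : Fin n) : fe n k < fo n k := Nat.lt_succ_self _

theorem eq_fe_or_eq_fo {n : ℕ} (i : Fin (2 * n)) : ∃ k, i = fe n k ∨ i = fo n k := by
  have hi := i.isLt
  refine ⟨⟨i.val / 2, by omega⟩, ?_⟩
  simp only [Fin.ext_iff, fe, fo]
  omega

namespace IsGradedSp

variable {F : Type} [Field F] {q : F} {n : ℕ} {B : Type} [Ring B] [Algebra F B]
  {g : Fin (2 * n) → Fin (2 * n) → B} {d : Fin n → B}

theorem qCommute_row (h : IsGradedSp q n g d) (hq : q ≠ 0) (i a b : Fin (2 * n)) :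
    QCommute F (g i a) (g i b) := by
  have h1 := h.refl i i a b
  refine .of_smul_eq (a := (q - lamIf q (b < a)) * qIf q (i = a))
    (b := qIf q (a = b) * qIf q (i = b))
    (mul_ne_zero (sub_lamIf_ne_zero hq _) (qIf_ne_zero hq _))
    (mul_ne_zero (qIf_ne_zero hq _) (qIf_ne_zero hq _)) ?_
  rw [sub_mul, sub_smul, sub_eq_iff_eq_add, ← h1]
  simp [qIf, lamIf]

theorem qCommute_col (h : IsGradedSp q n g d) (hq : q ≠ 0) {i j : Fin (2 * n)} (hij : i < j)
    (a : Fin (2 * n)) : QCommute F (g j a) (g i a) := by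
  have h1 := h.refl i j a a
  refine .of_smul_eq (a := (q - lamIf q True) * qIf q (i = a)) (b := qIf q (j = a))
    (mul_ne_zero (sub_lamIf_ne_zero hq _) (qIf_ne_zero hq _)) (qIf_ne_zero hq _) ?_
  rw [sub_mul, sub_smul, sub_eq_iff_eq_add]
  simpa [qIf, lamIf, hij, hij.ne] using h1.symm

theorem qCommute_of_eq (h : IsGradedSp q n g d) (hq : q ≠ 0) {i j a b : Fin (2 * n)}
    (hv : lamIf q (i < j) • (g j a * g i b) = lamIf q (b < a) • (g j a * g i b)) :
    QCommute F (g i a) (g j b) := by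
  have h1 := h.refl i j a b
  rw [mul_comm (lamIf q (i < j)), mul_comm (lamIf q (b < a)), mul_smul _ (lamIf q (i < j)),
    mul_smul _ (lamIf q (b < a)), hv, add_left_inj] at h1
  exact .of_smul_eq (mul_ne_zero (qIf_ne_zero hq _) (qIf_ne_zero hq _))
    (mul_ne_zero (qIf_ne_zero hq _) (qIf_ne_zero hq _)) h1

theorem qCommute_fo_fe (h : IsGradedSp q n g d) (hq : q ≠ 0) (k : Fin n) (j b : Fin (2 * n)) :
    QCommute F (g (fe n k) (fo n k)) (g j b) := by
  have hz1 : fo n k < b → g (fe n k) b = 0 := fun hb =>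
    h.tri _ _ ((fe_lt_fo n k).trans hb) fun H => by
      have : fo n k = b := Fin.ext H.2.symm
      exact hb.ne this
  have hz2 : j < fe n k → g j (fo n k) = 0 := fun hj =>
    h.tri _ _ (hj.trans (fe_lt_fo n k)) fun H => by
      simp only [fo, fe, Fin.lt_def] at H hj
      omega
  rcases lt_trichotomy b (fo n k) with hb | rfl | hb
  · rcases lt_trichotomy j (fe n k) with hj | rfl | hj
    · exact h.qCommute_of_eq hq (by simp [hz2 hj])
    · exact h.qCommute_row hq _ _ _
    · exact h.qCommute_of_eq hq (by simp [hj, hb, lamIf])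
  · rcases lt_trichotomy j (fe n k) with hj | rfl | hj
    · rw [hz2 hj]
      exact .zero_right _
    · exact .refl _
    · exact (h.qCommute_col hq hj _).symm
  · exact h.qCommute_of_eq hq (by simp [hz1 hb])

theorem qCommute_inv (h : IsGradedSp q n g d) (hq : q ≠ 0) (k : Fin n) (j b : Fin (2 * n)) :
    QCommute F (g j b) (d k) :=
  (h.qCommute_fo_fe hq k j b).symm.inverse_right (h.invR k) (h.invL k)

theorem qCommute_inv_inv (h : IsGradedSp q n g d) (hq : q ≠ 0) (k l : Fin n) :
    QCommute F (d k) (d l) :=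
  (h.qCommute_inv hq k _ _).symm.inverse_right (h.invR l) (h.invL l)

theorem fo_fe_eq (h : IsGradedSp q n g d) (hq : q ≠ 0) (k : Fin n) :
    g (fo n k) (fe n k) = (q ^ 2)⁻¹ • (g (fo n k) (fo n k) * (g (fe n k) (fe n k) * d k)) := by
  rw [← mul_assoc, h.quad, smul_mul_assoc, inv_smul_smul₀ (pow_ne_zero 2 hq), mul_assoc, h.invR,
    mul_one]

theorem qCommute_diag (h : IsGradedSp q n g d) (hq : q ≠ 0) (k : Fin n) :
    QCommute F (g (fo n k) (fo n k)) (g (fe n k) (fe n k)) := by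
  have h1 := h.refl (fe n k) (fo n k) (fe n k) (fo n k)
  have h2 : g (fo n k) (fe n k) * g (fe n k) (fo n k)
      = (q ^ 2)⁻¹ • (g (fo n k) (fo n k) * g (fe n k) (fe n k)) := by
    rw [h.quad, inv_smul_smul₀ (pow_ne_zero 2 hq)]
  have hne : fe n k ≠ fo n k := (fe_lt_fo n k).ne
  simp only [qIf, lamIf, hne, hne.symm, fe_lt_fo, (fe_lt_fo n k).le.not_gt, h2, smul_smul,
    if_true, if_false, one_smul, zero_mul, zero_smul, add_zero, one_mul] at h1
  refine QCommute.symm ⟨(q ^ 2)⁻¹, inv_ne_zero (pow_ne_zero 2 hq), ?_⟩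
  rw [eq_sub_of_add_eq h1, sub_eq_iff_eq_add, ← add_smul]
  nth_rw 1 [← one_smul F (g (fo n k) (fo n k) * _)]
  congr 1
  field_simp
  ring

/-- The values of all generators. -/
def gen (g : Fin (2 * n) → Fin (2 * n) → B) (d : Fin n → B) : SpGen n → B :=
  Sum.elim (fun p => g p.1 p.2) d

variable (F) in
/-- The subalgebra generated by the generators of row `r`. -/
def rowAlg (g : Fin (2 * n) → Fin (2 * n) → B) (d : Fin n → B) (r : Fin (2 * n)) :
    Submodule F B :=
  Subalgebra.toSubmodule (Algebra.adjoin F (gen g d '' {x | genRow n x = r}))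

theorem rowAlg_closed (r : Fin (2 * n)) :
    1 ≤ rowAlg F g d r ∧ rowAlg F g d r * rowAlg F g d r ≤ rowAlg F g d r :=
  ⟨Submodule.one_le_adjoin _, Submodule.adjoin_mul_self_le _⟩

theorem gen_mem_rowAlg (x : SpGen n) : gen g d x ∈ rowAlg F g d (genRow n x) :=
  Algebra.subset_adjoin ⟨x, rfl, rfl⟩

open Submodule in
theorem rowAlg_mul_le (h : IsGradedSp q n g d) (hq : q ≠ 0) {i j : Fin (2 * n)} (hij : i < j) :
    rowAlg F g d j * rowAlg F g d i ≤ rowAlg F g d i * rowAlg F g d j := by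
  apply adjoin_mul_adjoin_le
  rw [span_mul_span, span_le]
  have hmem {x y : SpGen n} (hx : genRow n x = i) (hy : genRow n y = j) :
      gen g d x * gen g d y ∈ span F (gen g d '' {x | genRow n x = i}) *
        span F (gen g d '' {x | genRow n x = j}) :=
    mul_mem_mul (subset_span ⟨x, hx, rfl⟩) (subset_span ⟨y, hy, rfl⟩)
  have hcomm {x y : SpGen n} (hx : genRow n x = i) (hy : genRow n y = j)
      (H : QCommute F (gen g d y) (gen g d x)) :
      gen g d y * gen g d x ∈ span F (gen g d '' {x | genRow n x = i}) *
        span F (gen g d '' {x | genRow n x = j}) := by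
    obtain ⟨c, -, H⟩ := H
    exact H ▸ smul_mem _ _ (hmem hx hy)
  rintro _ ⟨_, ⟨y, hy, rfl⟩, _, ⟨x, hx, rfl⟩, rfl⟩
  match x, y, hx, hy with
  | .inr k, .inl p, hx, hy => exact hcomm hx hy (h.qCommute_inv hq _ _ _)
  | .inr k, .inr l, hx, hy => exact hcomm hx hy (h.qCommute_inv_inv hq _ _)
  | .inl p, .inr k, hx, hy => exact hcomm hx hy (h.qCommute_inv hq _ _ _).symm
  | .inl (i, a), .inl (j, b), rfl, rfl =>
    have key {b a : Fin (2 * n)} (hba : b < a) : QCommute F (g j b) (g i a) :=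
      (h.qCommute_of_eq hq (by simp [show i < j from hij, hba, lamIf])).symm
    rcases lt_trichotomy b a with hba | rfl | hba
    · exact hcomm rfl rfl (key hba)
    · exact hcomm rfl rfl (h.qCommute_col hq hij _)
    · have h1 := h.refl i j a b
      have h2 := hcomm (x := .inl (i, b)) (y := .inl (j, a)) rfl rfl (key hba)
      have h3 := hmem (x := .inl (i, a)) (y := .inl (j, b)) rfl rfl
      have h0 : lamIf q (b < a) = 0 := if_neg hba.not_gt
      rw [h0, zero_mul, zero_smul, add_zero] at h1
      refine (smul_mem_iff _ (mul_ne_zero (qIf_ne_zero hq (a = b)) (qIf_ne_zero hq (i = b)))).1 ?_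
      change (qIf q (a = b) * qIf q (i = b)) • (g j b * g i a) ∈ _
      rw [← h1]
      exact add_mem (smul_mem _ _ h3) (smul_mem _ _ h2)

end IsGradedSp

/-! ### Ordered monomials span the graded algebra -/

theorem fst_eq_of_mem_rowA {n : ℕ} {k : Fin n} {p : Fin (2 * n) × Fin (2 * n)}
    (hp : p ∈ rowA n k) : p.1 = fe n k := by
  obtain ⟨j, -, rfl⟩ := List.mem_map.1 hp
  rfl

theorem mem_rowA {n : ℕ} {k : Fin n} {j : Fin (2 * n)} (hj : j.val ≤ 2 * k.val) :
    (fe n k, j) ∈ rowA n k :=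
  List.mem_map.2 ⟨j, List.mem_filter.2 ⟨List.mem_finRange j, by simpa using hj⟩, rfl⟩

theorem nodup_rowA (n : ℕ) (k : Fin n) : (rowA n k).Nodup :=
  ((List.nodup_finRange _).filter _).map fun _ _ h => (Prod.ext_iff.1 h).2

theorem fst_eq_and_lt_of_mem_rowB {n : ℕ} {k : Fin n} {p : Fin (2 * n) × Fin (2 * n)}
    (hp : p ∈ rowB n k) : p.1 = fo n k ∧ p.2 < fo n k := by
  obtain ⟨j, hj, rfl⟩ := List.mem_map.1 hp
  have h := (List.mem_filter.1 hj).2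
  simp only [decide_eq_true_eq] at h
  exact ⟨rfl, by simp only [Fin.lt_def, fo]; omega⟩

theorem mem_rowB {n : ℕ} {k : Fin n} {j : Fin (2 * n)} (hj : j.val + 2 ≤ 2 * k.val + 1) :
    (fo n k, j) ∈ rowB n k :=
  List.mem_map.2 ⟨j, List.mem_filter.2 ⟨List.mem_finRange j, by simpa using hj⟩, rfl⟩

theorem nodup_rowB (n : ℕ) (k : Fin n) : (rowB n k).Nodup :=
  ((List.nodup_finRange _).filter _).map fun _ _ h => (Prod.ext_iff.1 h).2

namespace IsGradedSp

variable {F : Type} [Field F] {q : F} {n : ℕ} {B : Type} [Ring B] [Algebra F B]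
  {g : Fin (2 * n) → Fin (2 * n) → B} {d : Fin n → B}

variable (F) in
/-- The span of the ordered monomials in the entries at the positions `l`. -/
def monSpan (g : Fin (2 * n) → Fin (2 * n) → B) (l : List (Fin (2 * n) × Fin (2 * n))) :
    Submodule F B :=
  (l.map fun p => powSpan F (g p.1 p.2)).prod

variable (F) in
/-- The span of the ordered monomials in the generators of row `2k`. -/
def evenSpan (g : Fin (2 * n) → Fin (2 * n) → B) (d : Fin n → B) (k : Fin n) : Submodule F B :=
  monSpan F g (rowA n k) * zpowSpan F (g (fe n k) (fo n k)) (d k)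

theorem evenSpan_closed (h : IsGradedSp q n g d) (hq : q ≠ 0) (k : Fin n) :
    1 ≤ evenSpan F g d k ∧ evenSpan F g d k * evenSpan F g d k ≤ evenSpan F g d k ∧
      (∀ j : Fin (2 * n), j.val ≤ 2 * k.val → powSpan F (g (fe n k) j) ≤ evenSpan F g d k) ∧
      zpowSpan F (g (fe n k) (fo n k)) (d k) ≤ evenSpan F g d k := by
  have key := Submodule.one_le_and_mul_le_list_prod
    (((rowA n k).map fun p => powSpan F (g p.1 p.2)) ++
      [zpowSpan F (g (fe n k) (fo n k)) (d k)]) ?_ ?_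
  · rw [List.prod_append, List.prod_singleton] at key
    refine ⟨key.1, key.2.1, fun j hj => key.2.2 _ ?_, key.2.2 _ (by simp)⟩
    exact List.mem_append_left _ (List.mem_map.2 ⟨_, mem_rowA hj, rfl⟩)
  · intro R hR
    rcases List.mem_append.1 hR with hR | hR
    · obtain ⟨p, -, rfl⟩ := List.mem_map.1 hR
      exact powSpan_closed _
    · rw [List.mem_singleton.1 hR]
      exact zpowSpan_closed (h.invR k) (h.invL k)
  · rw [List.pairwise_append]
    refine ⟨List.pairwise_map.2 ?_, List.pairwise_singleton _ _, ?_⟩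
    · refine List.pairwise_of_forall_mem_list fun p hp r hr => ?_
      rw [fst_eq_of_mem_rowA hp, fst_eq_of_mem_rowA hr]
      exact (h.qCommute_row hq _ _ _).powSpan_mul_le
    · intro R hR S hS
      obtain ⟨p, hp, rfl⟩ := List.mem_map.1 hR
      rw [List.mem_singleton.1 hS, fst_eq_of_mem_rowA hp]
      exact QCommute.zpowSpan_mul_le (h.qCommute_row hq _ _ _) (h.qCommute_inv hq _ _ _)

theorem rowAlg_fe_le (h : IsGradedSp q n g d) (hq : q ≠ 0) (k : Fin n) :
    rowAlg F g d (fe n k) ≤ evenSpan F g d k := by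
  obtain ⟨h1, h2, h3, h4⟩ := h.evenSpan_closed hq k
  refine Submodule.adjoin_le_of_mul_le h1 h2 ?_
  rintro _ ⟨x, hx, rfl⟩
  match x, hx with
  | .inl (i, j), hx =>
    obtain rfl : i = fe n k := hx
    by_cases hj : j.val ≤ 2 * k.val
    · exact h3 j hj (self_mem_powSpan _)
    by_cases hj' : j = fo n k
    · subst hj'
      exact h4 (mem_zpowSpan_left _ _)
    · have h0 : g (fe n k) j = 0 :=
        h.tri _ _ (not_le.1 hj) fun H => hj' (Fin.ext H.2)
      change g (fe n k) j ∈ _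
      rw [h0]
      exact zero_mem _
  | .inr l, hx =>
    obtain rfl : l = k := by
      have : 2 * l.val = 2 * k.val := congrArg Fin.val hx
      exact Fin.ext (by omega)
    exact h4 (mem_zpowSpan_right _ _)

theorem rowAlg_fo_le (h : IsGradedSp q n g d) (hq : q ≠ 0) (k : Fin n) :
    rowAlg F g d (fo n k) ≤ powSpan F (g (fo n k) (fe n k)) *
      (powSpan F (g (fo n k) (fo n k)) * monSpan F g (rowB n k)) := by
  have key := Submodule.one_le_and_mul_le_list_prod
    (((fo n k, fe n k) :: (fo n k, fo n k) :: rowB n k).map fun p => powSpan F (g p.1 p.2)) ?_ ?_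
  · rw [List.map_cons, List.map_cons, List.prod_cons, List.prod_cons] at key
    refine Submodule.adjoin_le_of_mul_le key.1 key.2.1 ?_
    rintro _ ⟨x, hx, rfl⟩
    match x, hx with
    | .inl (i, j), hx =>
      obtain rfl : i = fo n k := hx
      have hmem (hj : (fo n k, j) ∈ (fo n k, fe n k) :: (fo n k, fo n k) :: rowB n k) :
          g (fo n k) j ∈ powSpan F (g (fo n k) (fe n k)) *
            (powSpan F (g (fo n k) (fo n k)) * monSpan F g (rowB n k)) :=
        key.2.2 _ (List.mem_map_of_mem (f := fun p : _ × _ => powSpan F (g p.1 p.2)) hj)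
          (self_mem_powSpan _)
      change g (fo n k) j ∈ _
      by_cases h1 : j.val + 2 ≤ 2 * k.val + 1
      · exact hmem (by simp [mem_rowB h1])
      by_cases h2 : j = fe n k
      · exact hmem (by simp [h2])
      by_cases h3 : j = fo n k
      · exact hmem (by simp [h3])
      · have hj : fo n k < j := by
          simp only [Fin.ext_iff, fe, fo, Fin.lt_def] at h2 h3 ⊢
          omega
        rw [h.tri _ _ hj fun H => by simp only [fo] at H; omega]
        exact zero_mem _
    | .inr l, hx =>
      have : 2 * l.val = 2 * k.val + 1 := congrArg Fin.val hx
      omega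
  · intro R hR
    obtain ⟨p, -, rfl⟩ := List.mem_map.1 hR
    exact powSpan_closed _
  · refine List.pairwise_map.2 (List.pairwise_of_forall_mem_list fun p hp r hr => ?_)
    have hfst {p : Fin (2 * n) × Fin (2 * n)}
        (hp : p ∈ (fo n k, fe n k) :: (fo n k, fo n k) :: rowB n k) : p.1 = fo n k := by
      rcases List.mem_cons.1 hp with rfl | hp
      · rfl
      rcases List.mem_cons.1 hp with rfl | hp
      · rfl
      exact (fst_eq_and_lt_of_mem_rowB hp).1
    rw [hfst hp, hfst hr]
    exact (h.qCommute_row hq _ _ _).powSpan_mul_le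

/-- Powers of `s_{i' i}` can be eliminated by the quadratic relation. -/
theorem powSpan_fo_fe_le (h : IsGradedSp q n g d) (hq : q ≠ 0) (k : Fin n) :
    powSpan F (g (fo n k) (fe n k)) ≤ evenSpan F g d k * powSpan F (g (fo n k) (fo n k)) := by
  set x := g (fo n k) (fo n k)
  set y := g (fe n k) (fe n k) * d k
  have hxy : QCommute F x y := (h.qCommute_diag hq k).mul_right (h.qCommute_inv hq _ _ _)
  obtain ⟨h1, h2, h3, h4⟩ := h.evenSpan_closed hq k
  have hy : y ∈ evenSpan F g d k :=
    h2 (Submodule.mul_mem_mul (h3 (fe n k) le_rfl (self_mem_powSpan _))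
      (h4 (mem_zpowSpan_right _ _)))
  have hyp (m : ℕ) : y ^ m ∈ evenSpan F g d k := by
    induction m with
    | zero => simpa using Submodule.one_le.1 h1
    | succ m ih => exact pow_succ y m ▸ h2 (Submodule.mul_mem_mul ih hy)
  have hz : ∃ c : F, g (fo n k) (fe n k) = c • (y * x) := by
    obtain ⟨c, -, hc⟩ := hxy
    exact ⟨(q ^ 2)⁻¹ * c, by rw [h.fo_fe_eq hq, mul_smul]; exact congrArg _ hc⟩
  have hpow (m : ℕ) : ∃ c : F, g (fo n k) (fe n k) ^ m = c • (y ^ m * x ^ m) := by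
    obtain ⟨c, hc⟩ := hz
    induction m with
    | zero => exact ⟨1, by simp⟩
    | succ m ih =>
      obtain ⟨c', hc'⟩ := ih
      obtain ⟨e, -, he⟩ := hxy.pow_left m
      refine ⟨c' * c * e, ?_⟩
      rw [pow_succ, hc', hc, smul_mul_smul_comm, mul_smul _ e]
      congr 1
      calc y ^ m * x ^ m * (y * x) = y ^ m * (x ^ m * y) * x := by simp only [mul_assoc]
        _ = e • (y ^ (m + 1) * x ^ (m + 1)) := by
          rw [he, mul_smul_comm, smul_mul_assoc, pow_succ, pow_succ]
          simp only [mul_assoc]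
  rw [powSpan, Submodule.span_le]
  rintro _ ⟨m, rfl⟩
  obtain ⟨c, hc⟩ := hpow m
  change g (fo n k) (fe n k) ^ m ∈ _
  rw [hc]
  exact Submodule.smul_mem _ _ (Submodule.mul_mem_mul (hyp m) (Submodule.subset_span ⟨m, rfl⟩))

variable (F) in
/-- The span of the ordered monomials in the generators of the rows `2k` and `2k + 1`. -/
def blockSpan (g : Fin (2 * n) → Fin (2 * n) → B) (d : Fin n → B) (k : Fin n) : Submodule F B :=
  evenSpan F g d k * powSpan F (g (fo n k) (fo n k)) * monSpan F g (rowB n k)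

theorem rowAlg_mul_rowAlg_le (h : IsGradedSp q n g d) (hq : q ≠ 0) (k : Fin n) :
    rowAlg F g d (fe n k) * rowAlg F g d (fo n k) ≤ blockSpan F g d k := by
  set P := powSpan F (g (fo n k) (fo n k))
  set M := monSpan F g (rowB n k)
  set R := evenSpan F g d k
  calc rowAlg F g d (fe n k) * rowAlg F g d (fo n k)
      ≤ R * (powSpan F (g (fo n k) (fe n k)) * (P * M)) :=
        mul_le_mul' (h.rowAlg_fe_le hq k) (h.rowAlg_fo_le hq k)
    _ ≤ R * (R * P * (P * M)) :=
        mul_le_mul_right (mul_le_mul_left (h.powSpan_fo_fe_le hq k) _) _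
    _ = R * R * (P * P) * M := by simp only [mul_assoc]
    _ ≤ R * P * M :=
        mul_le_mul_left (mul_le_mul' (h.evenSpan_closed hq k).2.1 (powSpan_closed _).2) _

theorem prod_blockSpan_eq_top (h : IsGradedSp q n g d) (hq : q ≠ 0)
    (hgen : Algebra.adjoin F (Set.range (gen g d)) = ⊤) :
    ((List.finRange n).map (blockSpan F g d)).prod = ⊤ := by
  have key := Submodule.one_le_and_mul_le_list_prod
    ((List.finRange n).flatMap fun k => [rowAlg F g d (fe n k), rowAlg F g d (fo n k)]) ?_ ?_
  · have hle : ((List.finRange n).flatMap fun k =>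
        [rowAlg F g d (fe n k), rowAlg F g d (fo n k)]).prod ≤
          ((List.finRange n).map (blockSpan F g d)).prod := by
      generalize List.finRange n = l
      induction l with
      | nil => simp
      | cons k l ih =>
        rw [List.flatMap_cons, List.prod_append, List.map_cons, List.prod_cons]
        refine mul_le_mul' ?_ ih
        simpa using h.rowAlg_mul_rowAlg_le hq k
    refine top_le_iff.1 (le_trans ?_ hle)
    rw [← Algebra.top_toSubmodule, ← hgen]
    refine Submodule.adjoin_le_of_mul_le key.1 key.2.1 ?_
    rintro _ ⟨x, rfl⟩
    refine key.2.2 (rowAlg F g d (genRow n x)) ?_ (gen_mem_rowAlg x)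
    obtain ⟨k, hk⟩ := eq_fe_or_eq_fo (genRow n x)
    refine List.mem_flatMap.2 ⟨k, List.mem_finRange k, ?_⟩
    rcases hk with hk | hk <;> simp [hk]
  · intro R hR
    obtain ⟨k, -, hR⟩ := List.mem_flatMap.1 hR
    simp only [List.mem_cons, List.not_mem_nil, or_false] at hR
    rcases hR with rfl | rfl <;> exact rowAlg_closed _
  · rw [List.pairwise_flatMap]
    refine ⟨fun k _ => ?_, ?_⟩
    · simpa using h.rowAlg_mul_le hq (fe_lt_fo n k)
    · refine (List.pairwise_lt_finRange n).imp fun {k l} hkl R hR S hS => ?_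
      simp only [List.mem_cons, List.not_mem_nil, or_false] at hR hS
      have hkl' : k.val < l.val := hkl
      rcases hR with rfl | rfl <;> rcases hS with rfl | rfl <;>
        refine h.rowAlg_mul_le hq ?_ <;> simp only [fe, fo, Fin.lt_def] <;> omega

/-- The `k`-th factor of an ordered monomial. -/
def blockMon (g : Fin (2 * n) → Fin (2 * n) → B) (d : Fin n → B) (k : Fin n)
    (e : (Fin (2 * n) × Fin (2 * n) → ℕ) × ℤ) : B :=
  ((rowA n k).map fun p => g p.1 p.2 ^ e.1 p).prod * zpowPair (g (fe n k) (fo n k)) (d k) e.2 *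
    g (fo n k) (fo n k) ^ e.1 (fo n k, fo n k) * ((rowB n k).map fun p => g p.1 p.2 ^ e.1 p).prod

open Submodule in
theorem blockSpan_le (k : Fin n) :
    blockSpan F g d k ≤ span F (Set.range (blockMon g d k)) := by
  have hmon (l : List (Fin (2 * n) × Fin (2 * n))) (hl : l.Nodup) :=
    list_prod_span_range_le (F := F) (fun (p : Fin (2 * n) × Fin (2 * n)) (m : ℕ) => g p.1 p.2 ^ m)
      l hl
  refine (mul_le_mul' (mul_le_mul' (mul_le_mul' (hmon _ (nodup_rowA n k)) le_rfl) le_rfl)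
    (hmon _ (nodup_rowB n k))).trans ?_
  rw [zpowSpan, powSpan, span_mul_span, span_mul_span, span_mul_span, span_le]
  rintro _ ⟨_, ⟨_, ⟨_, ⟨κ, rfl⟩, _, ⟨z, rfl⟩, rfl⟩, _, ⟨m, rfl⟩, rfl⟩, _, ⟨μ, rfl⟩, rfl⟩
  refine subset_span ⟨(fun p => if p.1 = fe n k then κ p else
    if p = (fo n k, fo n k) then m else μ p, z), ?_⟩
  have hne : fo n k ≠ fe n k := (fe_lt_fo n k).ne'
  have hA : (rowA n k).map (fun p => g p.1 p.2 ^ (if p.1 = fe n k then κ p else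
      if p = (fo n k, fo n k) then m else μ p)) = (rowA n k).map fun p => g p.1 p.2 ^ κ p :=
    List.map_congr_left fun p hp => by rw [if_pos (fst_eq_of_mem_rowA hp)]
  have hB : (rowB n k).map (fun p => g p.1 p.2 ^ (if p.1 = fe n k then κ p else
      if p = (fo n k, fo n k) then m else μ p)) = (rowB n k).map fun p => g p.1 p.2 ^ μ p :=
    List.map_congr_left fun p hp => by
      obtain ⟨h1, h2⟩ := fst_eq_and_lt_of_mem_rowB hp
      rw [if_neg (h1 ▸ hne), if_neg fun H => h2.ne (congrArg Prod.snd H)]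
  simp only [blockMon, hA, hB, if_neg hne, if_true]

open Submodule in
/-- The ordered monomials span the graded algebra. -/
theorem span_monomSp_eq_top (h : IsGradedSp q n g d) (hq : q ≠ 0)
    (hgen : Algebra.adjoin F (Set.range (gen g d)) = ⊤) :
    span F {x : B | ∃ kN kZ, x = monomSp n (fun p => g p.1 p.2) d kN kZ} = ⊤ := by
  rw [← top_le_iff, ← h.prod_blockSpan_eq_top hq hgen]
  have hle : ((List.finRange n).map (blockSpan F g d)).prod ≤
      ((List.finRange n).map fun k => span F (Set.range (blockMon g d k))).prod :=
    List.prod_le_prod' fun k _ => blockSpan_le k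
  refine (hle.trans (list_prod_span_range_le _ _ (List.nodup_finRange n))).trans (span_mono ?_)
  rintro _ ⟨κ, rfl⟩
  refine ⟨fun p => (κ ⟨p.1.val / 2, by have := p.1.isLt; omega⟩).1 p, fun k => (κ k).2, ?_⟩
  have hfe (k : Fin n) (hk : (fe n k).val / 2 < n) : (⟨(fe n k).val / 2, hk⟩ : Fin n) = k :=
    Fin.ext (by simp only [fe]; omega)
  have hfo (k : Fin n) (hk : (fo n k).val / 2 < n) : (⟨(fo n k).val / 2, hk⟩ : Fin n) = k :=
    Fin.ext (by simp only [fo]; omega)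
  refine congrArg (List.prod (α := B)) (List.map_congr_left fun k _ => ?_)
  simp only [blockMon, hfo]
  congr 2
  · congr 2
    refine List.map_congr_left fun p hp => ?_
    simp only [fst_eq_of_mem_rowA hp, hfe]
  · refine List.map_congr_left fun p hp => ?_
    simp only [(fst_eq_and_lt_of_mem_rowB hp).1, hfo]

end IsGradedSp

/-! ### Leading terms -/

section LeadingTerms

open Polynomial Submodule

variable {F X A : Type} [Field F] [Ring A] [Algebra F A]

/-- The homomorphism to the Rees algebra which records the weight `wt x` of each generator. -/
def leadHom (wt : X → ℕ) (π : FreeAlgebra F X →ₐ[F] A) : FreeAlgebra F X →ₐ[F] A[X] :=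
  FreeAlgebra.lift F fun x => monomial (wt x) (π (FreeAlgebra.ι F x))

/-- The words in the generators. -/
def freeWords (F X : Type) [Field F] : Submonoid (FreeAlgebra F X) :=
  Submonoid.closure (Set.range (FreeAlgebra.ι F))

variable (wt : X → ℕ) (π : FreeAlgebra F X →ₐ[F] A)

theorem leadHom_ι (x : X) :
    leadHom wt π (FreeAlgebra.ι F x) = monomial (wt x) (π (FreeAlgebra.ι F x)) :=
  FreeAlgebra.lift_ι_apply _ _

theorem leadHom_mul_eq {u v : FreeAlgebra F X} {d e : ℕ} (hu : leadHom wt π u = monomial d (π u))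
    (hv : leadHom wt π v = monomial e (π v)) :
    leadHom wt π (u * v) = monomial (d + e) (π (u * v)) := by
  rw [map_mul, map_mul, hu, hv, monomial_mul_monomial]

theorem exists_leadHom_eq {u : FreeAlgebra F X} (hu : u ∈ freeWords F X) :
    ∃ e, leadHom wt π u = monomial e (π u) := by
  induction hu using Submonoid.closure_induction with
  | mem _ h =>
    obtain ⟨x, rfl⟩ := h
    exact ⟨_, leadHom_ι wt π x⟩
  | one => exact ⟨0, by simp⟩
  | mul u v _ _ hu hv =>
    obtain ⟨d, hd⟩ := hu
    obtain ⟨e, he⟩ := hv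
    exact ⟨_, leadHom_mul_eq wt π hd he⟩

/-- The span of the values of the words of weight less than `m`. -/
def lowerSpan (m : ℕ) : Submodule F A :=
  span F {a | ∃ u ∈ freeWords F X, ∃ e < m, leadHom wt π u = monomial e (π u) ∧ π u = a}

variable {wt π}

theorem mem_lowerSpan {u : FreeAlgebra F X} (hu : u ∈ freeWords F X) {e m : ℕ}
    (he : leadHom wt π u = monomial e (π u)) (hem : e < m) : π u ∈ lowerSpan wt π m :=
  subset_span ⟨u, hu, e, hem, he, rfl⟩

theorem ι_mem_freeWords (x : X) : FreeAlgebra.ι F x ∈ freeWords F X :=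
  Submonoid.subset_closure ⟨x, rfl⟩

theorem mul_mem_lowerSpan (x : X) {a : A} {m : ℕ} (ha : a ∈ lowerSpan wt π m) :
    π (FreeAlgebra.ι F x) * a ∈ lowerSpan wt π (m + wt x) := by
  induction ha using span_induction with
  | mem _ h =>
    obtain ⟨u, hu, e, hem, he, rfl⟩ := h
    rw [← map_mul]
    exact mem_lowerSpan (mul_mem (ι_mem_freeWords x) hu)
      (leadHom_mul_eq wt π (leadHom_ι wt π x) he) (by omega)
  | zero => rw [mul_zero]; exact zero_mem _
  | add a b _ _ ha hb => rw [mul_add]; exact add_mem ha hb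
  | smul c a _ ha => rw [mul_smul_comm]; exact smul_mem _ _ ha

theorem lowerSpan_mul_mem (x : X) {a : A} {m : ℕ} (ha : a ∈ lowerSpan wt π m) :
    a * π (FreeAlgebra.ι F x) ∈ lowerSpan wt π (m + wt x) := by
  induction ha using span_induction with
  | mem _ h =>
    obtain ⟨u, hu, e, hem, he, rfl⟩ := h
    rw [← map_mul]
    exact mem_lowerSpan (mul_mem hu (ι_mem_freeWords x))
      (leadHom_mul_eq wt π he (leadHom_ι wt π x)) (by omega)
  | zero => rw [zero_mul]; exact zero_mem _
  | add a b _ _ ha hb => rw [add_mul]; exact add_mem ha hb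
  | smul c a _ ha => rw [smul_mul_assoc]; exact smul_mem _ _ ha

variable (wt π) in
/-- The polynomials whose coefficients have lower weight than their degree. -/
def lowerPoly : Submodule F A[X] where
  carrier := {p | ∀ m, p.coeff m ∈ lowerSpan wt π m}
  zero_mem' m := by rw [coeff_zero]; exact zero_mem _
  add_mem' hp hr m := by rw [coeff_add]; exact add_mem (hp m) (hr m)
  smul_mem' c p hp m := by rw [coeff_smul]; exact smul_mem _ c (hp m)

theorem monomial_mem_lowerPoly {a : A} {m : ℕ} (ha : a ∈ lowerSpan wt π m) :
    monomial m a ∈ lowerPoly wt π := by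
  intro k
  rw [coeff_monomial]
  split_ifs with h
  · exact h ▸ ha
  · exact zero_mem _

theorem leadHom_mul_mem (u : FreeAlgebra F X) :
    ∀ {p : A[X]}, p ∈ lowerPoly wt π → leadHom wt π u * p ∈ lowerPoly wt π := by
  induction u using FreeAlgebra.induction with
  | grade0 r =>
    intro p hp
    rw [AlgHom.commutes, ← Algebra.smul_def]
    exact smul_mem _ r hp
  | grade1 x =>
    intro p hp m
    rw [leadHom_ι, ← C_mul_X_pow_eq_monomial, mul_assoc, coeff_C_mul, coeff_X_pow_mul']
    split_ifs with h
    · simpa [Nat.sub_add_cancel h] using mul_mem_lowerSpan x (hp (m - wt x))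
    · rw [mul_zero]
      exact zero_mem _
  | mul u v hu hv =>
    intro p hp
    rw [map_mul, mul_assoc]
    exact hu (hv hp)
  | add u v hu hv =>
    intro p hp
    rw [map_add, add_mul]
    exact add_mem (hu hp) (hv hp)

theorem mul_leadHom_mem (u : FreeAlgebra F X) :
    ∀ {p : A[X]}, p ∈ lowerPoly wt π → p * leadHom wt π u ∈ lowerPoly wt π := by
  induction u using FreeAlgebra.induction with
  | grade0 r =>
    intro p hp
    rw [AlgHom.commutes, ← Algebra.commutes, ← Algebra.smul_def]
    exact smul_mem _ r hp
  | grade1 x =>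
    intro p hp m
    rw [leadHom_ι, ← C_mul_X_pow_eq_monomial, ← X_pow_mul_C, ← mul_assoc, coeff_mul_C,
      coeff_mul_X_pow']
    split_ifs with h
    · simpa [Nat.sub_add_cancel h] using lowerSpan_mul_mem x (hp (m - wt x))
    · rw [zero_mul]
      exact zero_mem _
  | mul u v hu hv =>
    intro p hp
    rw [map_mul, ← mul_assoc]
    exact hv (hu hp)
  | add u v hu hv =>
    intro p hp
    rw [map_add, mul_add]
    exact add_mem (hu hp) (hv hp)

variable (wt π) in
/-- The congruence of having the same leading terms; its quotient is the associated graded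
algebra of `A` for the filtration by weight. -/
def leadCon : RingCon (FreeAlgebra F X) where
  r u v := leadHom wt π u - leadHom wt π v ∈ lowerPoly wt π
  iseqv :=
    { refl := fun u => by rw [sub_self]; exact zero_mem _
      symm := fun {u v} h => by rw [← neg_sub]; exact neg_mem h
      trans := fun {u v w} h h' => by rw [← sub_add_sub_cancel]; exact add_mem h h' }
  add' {u v w x} h h' := by
    rw [map_add, map_add, add_sub_add_comm]
    exact add_mem h h'
  mul' {u v w x} h h' := by
    have : leadHom wt π (u * w) - leadHom wt π (v * x) =
        leadHom wt π u * (leadHom wt π w - leadHom wt π x) +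
          (leadHom wt π u - leadHom wt π v) * leadHom wt π x := by
      rw [map_mul, map_mul, mul_sub, sub_mul, sub_add_sub_cancel]
    rw [this]
    exact add_mem (leadHom_mul_mem u h') (mul_leadHom_mem x h)

theorem leadCon_mk_eq_iff {u v : FreeAlgebra F X} :
    (leadCon wt π).mkₐ F u = (leadCon wt π).mkₐ F v ↔
      leadHom wt π u - leadHom wt π v ∈ lowerPoly wt π :=
  (leadCon wt π).eq

theorem leadCon_mk_eq_of_sub_mem {u v : FreeAlgebra F X} {m : ℕ}
    (hu : leadHom wt π u = monomial m (π u)) (hv : leadHom wt π v = monomial m (π v))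
    (h : π u - π v ∈ lowerSpan wt π m) :
    (leadCon wt π).mkₐ F u = (leadCon wt π).mkₐ F v := by
  rw [leadCon_mk_eq_iff, hu, hv, ← map_sub]
  exact monomial_mem_lowerPoly h

theorem leadCon_mk_eq_of_eq {u v : FreeAlgebra F X} {m : ℕ}
    (hu : leadHom wt π u = monomial m (π u)) (hv : leadHom wt π v = monomial m (π v))
    (h : π u = π v) : (leadCon wt π).mkₐ F u = (leadCon wt π).mkₐ F v :=
  leadCon_mk_eq_of_sub_mem hu hv (by rw [h, sub_self]; exact zero_mem _)

theorem span_freeWords : span F (freeWords F X : Set (FreeAlgebra F X)) = ⊤ := by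
  rw [freeWords, ← Algebra.adjoin_eq_span, FreeAlgebra.adjoin_range_ι, Algebra.top_toSubmodule]

/-- Words which span the associated graded algebra span the filtered algebra. -/
theorem span_image_eq_top_of_leadCon (hπ : Function.Surjective π) {T : Set (FreeAlgebra F X)}
    (hT : T ⊆ freeWords F X) (h : span F ((leadCon wt π).mkₐ F '' T) = ⊤) :
    span F (π '' T) = ⊤ := by
  have hword (m : ℕ) : lowerSpan wt π m ≤ span F (π '' T) := by
    induction m with
    | zero =>
      refine span_le.2 ?_
      rintro _ ⟨-, -, e, he, -⟩
      omega
    | succ m ih =>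
      refine span_le.2 ?_
      rintro _ ⟨w, hw, e, he, hlead, rfl⟩
      rcases (Nat.lt_succ_iff_lt_or_eq.1 he) with he | rfl
      · exact ih (mem_lowerSpan hw hlead he)
      have hmem : (leadCon wt π).mkₐ F w ∈
          (span F T).map ((leadCon wt π).mkₐ F).toLinearMap := by
        rw [map_span]
        exact h ▸ mem_top
      obtain ⟨u, hu, huw⟩ := hmem
      have hcoeff := leadCon_mk_eq_iff.1 huw e
      rw [coeff_sub, hlead, coeff_monomial_same] at hcoeff
      have hu' : (leadHom wt π u).coeff e ∈ span F (π '' T) := by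
        clear huw hcoeff
        induction hu using span_induction with
        | mem t ht =>
          obtain ⟨d, hd⟩ := exists_leadHom_eq wt π (hT ht)
          rw [hd, coeff_monomial]
          split_ifs
          · exact subset_span ⟨t, ht, rfl⟩
          · exact zero_mem _
        | zero => simp
        | add u v _ _ hu hv =>
          rw [map_add, coeff_add]
          exact add_mem hu hv
        | smul c u _ hu =>
          rw [map_smul, coeff_smul]
          exact smul_mem _ c hu
      simpa using sub_mem hu' (ih hcoeff)
  rw [← top_le_iff, ← LinearMap.range_eq_top.2 (show Function.Surjective π.toLinearMap from hπ),
    LinearMap.range_eq_map, ← span_freeWords, map_span, span_le]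
  rintro _ ⟨w, hw, rfl⟩
  obtain ⟨e, he⟩ := exists_leadHom_eq wt π hw
  exact hword (e + 1) (mem_lowerSpan hw he e.lt_succ_self)

end LeadingTerms

/-! ### The associated graded algebra of `𝒮` -/

/-- The weight of a generator: `s_ij` has weight `i - j + 1`. -/
def wtSp (n : ℕ) : SpGen n → ℕ := Sum.elim (fun p => p.1.val + 1 - p.2.val) fun _ => 0

section Symplectic

variable (F : Type) [Field F] (q : F) (n : ℕ)

/-- The projection from the free algebra onto `𝒮`. -/
abbrev projSp : FreeAlgebra F (SpGen n) →ₐ[F] AlgSp F q n := RingQuot.mkAlgHom F (SpRel F q n)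

theorem projSp_mul_eq_zero {i a j b : Fin (2 * n)}
    (h : i.val + 1 < a.val ∨ j.val + 1 < b.val) :
    projSp F q n (SpFreeS F n i a * SpFreeS F n j b) = 0 := by
  have hz {i a : Fin (2 * n)} (h : i.val + 1 < a.val) : projSp F q n (SpFreeS F n i a) = 0 :=
    (RingQuot.mkAlgHom_rel F (SpRel.tri i a (Fin.lt_def.2 (by omega)) (by omega))).trans
      (map_zero _)
  rcases h with h | h
  · rw [map_mul, hz h, zero_mul]
  · rw [map_mul, hz h, mul_zero]

theorem leadHom_SpFreeS_mul (i a j b : Fin (2 * n)) :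
    leadHom (wtSp n) (projSp F q n) (SpFreeS F n i a * SpFreeS F n j b) =
      Polynomial.monomial (i.val + j.val + 2 - (a.val + b.val))
        (projSp F q n (SpFreeS F n i a * SpFreeS F n j b)) := by
  have key := leadHom_mul_eq _ _ (leadHom_ι (wtSp n) (projSp F q n) (.inl (i, a)))
    (leadHom_ι (wtSp n) (projSp F q n) (.inl (j, b)))
  refine key.trans ?_
  change Polynomial.monomial _ (projSp F q n (SpFreeS F n i a * SpFreeS F n j b)) = _
  by_cases h : i.val + 1 < a.val ∨ j.val + 1 < b.val
  · simp only [projSp_mul_eq_zero F q n h, Polynomial.monomial_zero_right]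
  · congr 2
    simp only [wtSp, Sum.elim_inl]
    omega

theorem projSp_mul_mem_lowerSpan (i a j b : Fin (2 * n)) {m : ℕ}
    (h : i.val + j.val + 2 < a.val + b.val + m) :
    projSp F q n (SpFreeS F n i a * SpFreeS F n j b) ∈ lowerSpan (wtSp n) (projSp F q n) m := by
  by_cases h0 : i.val + 1 < a.val ∨ j.val + 1 < b.val
  · rw [projSp_mul_eq_zero F q n h0]
    exact zero_mem _
  · exact mem_lowerSpan (mul_mem (ι_mem_freeWords _) (ι_mem_freeWords _))
      (leadHom_SpFreeS_mul F q n i a j b) (by omega)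

theorem lamIf_smul_mem {M : Type} [AddCommGroup M] [Module F M] {S : Submodule F M} {x : M}
    {P : Prop} [Decidable P] (h : P → x ∈ S) : lamIf q P • x ∈ S := by
  unfold lamIf
  split_ifs with hP
  · exact S.smul_mem _ (h hP)
  · rw [zero_smul]
    exact zero_mem _

open Polynomial in
/-- The quotient by `leadCon` satisfies the homogeneous form of the relations. -/
theorem isGradedSp_leadCon :
    IsGradedSp q n
      (fun i j => (leadCon (wtSp n) (projSp F q n)).mkₐ F (SpFreeS F n i j))
      (fun k => (leadCon (wtSp n) (projSp F q n)).mkₐ F (FreeAlgebra.ι F (Sum.inr k))) where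
  tri i j h h' := by
    rw [← map_zero ((leadCon (wtSp n) (projSp F q n)).mkₐ F)]
    exact leadCon_mk_eq_of_eq (leadHom_ι _ _ _) (by simp)
      (RingQuot.mkAlgHom_rel F (SpRel.tri i j h h'))
  quad k := by
    rw [← map_mul, ← map_mul, ← map_smul]
    have hl := leadHom_SpFreeS_mul F q n (fo n k) (fo n k) (fe n k) (fe n k)
    have hr := leadHom_SpFreeS_mul F q n (fo n k) (fe n k) (fe n k) (fo n k)
    rw [show (fo n k).val + (fe n k).val + 2 - ((fo n k).val + (fe n k).val) = 2 by omega] at hl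
    rw [show (fo n k).val + (fe n k).val + 2 - ((fe n k).val + (fo n k).val) = 2 by omega] at hr
    refine leadCon_mk_eq_of_sub_mem hl (by rw [map_smul, hr, map_smul, smul_monomial]) ?_
    have h := RingQuot.mkAlgHom_rel F (SpRel.quad (F := F) (q := q) k)
    have h' : projSp F q n (SpFreeS F n (fo n k) (fo n k) * SpFreeS F n (fe n k) (fe n k)) =
        projSp F q n (q ^ 2 • (SpFreeS F n (fo n k) (fe n k) * SpFreeS F n (fe n k) (fo n k)))
          + projSp F q n (q ^ 3 • 1) := by
      rw [← map_add, Algebra.smul_def, ← Algebra.algebraMap_eq_smul_one]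
      exact h
    rw [h', add_sub_cancel_left, map_smul]
    exact Submodule.smul_mem _ _ (mem_lowerSpan (one_mem _) (e := 0) (by simp) two_pos)
  invR k := by
    rw [← map_mul, ← map_one ((leadCon (wtSp n) (projSp F q n)).mkₐ F)]
    refine leadCon_mk_eq_of_eq (m := 0) ?_ (by simp) (RingQuot.mkAlgHom_rel F (SpRel.invR k))
    refine (leadHom_mul_eq _ _ (leadHom_ι _ _ _) (leadHom_ι _ _ _)).trans ?_
    simp [wtSp, fe, fo, SpFreeS]
  invL k := by
    rw [← map_mul, ← map_one ((leadCon (wtSp n) (projSp F q n)).mkₐ F)]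
    refine leadCon_mk_eq_of_eq (m := 0) ?_ (by simp) (RingQuot.mkAlgHom_rel F (SpRel.invL k))
    refine (leadHom_mul_eq _ _ (leadHom_ι _ _ _) (leadHom_ι _ _ _)).trans ?_
    simp [wtSp, fe, fo, SpFreeS]
  refl i j a b := by
    simp only [← map_mul, ← map_smul, ← map_add]
    have hl (c c' : F) (x y z w : Fin (2 * n)) (x' y' z' w' : Fin (2 * n)) {m : ℕ}
        (h : x.val + z.val + 2 - (y.val + w.val) = m)
        (h' : x'.val + z'.val + 2 - (y'.val + w'.val) = m) :
        leadHom (wtSp n) (projSp F q n) (c • (SpFreeS F n x y * SpFreeS F n z w)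
            + c' • (SpFreeS F n x' y' * SpFreeS F n z' w')) =
          monomial m (projSp F q n (c • (SpFreeS F n x y * SpFreeS F n z w)
            + c' • (SpFreeS F n x' y' * SpFreeS F n z' w'))) := by
      simp only [map_add, map_smul, leadHom_SpFreeS_mul, h, h', smul_monomial]
    refine leadCon_mk_eq_of_sub_mem (m := i.val + j.val + 2 - (a.val + b.val))
      (hl _ _ _ _ _ _ _ _ _ _ (by omega) (by omega))
      (hl _ _ _ _ _ _ _ _ _ _ (by omega) (by omega)) ?_
    have h := RingQuot.mkAlgHom_rel F (SpRel.refl (F := F) (q := q) (n := n) (i, j) (a, b))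
    rw [reflLHS_apply, reflRHS_apply] at h
    have h1 := lamIf_smul_mem F q (P := a < j)
      (fun H => projSp_mul_mem_lowerSpan F q n i j a b
        (m := i.val + j.val + 2 - (a.val + b.val)) (by rw [Fin.lt_def] at H; omega))
    have h2 := lamIf_smul_mem F q (P := b < i)
      (fun H => projSp_mul_mem_lowerSpan F q n j i b a
        (m := i.val + j.val + 2 - (a.val + b.val)) (by rw [Fin.lt_def] at H; omega))
    have h3 := lamIf_smul_mem F q (P := a < i)
      (fun H => projSp_mul_mem_lowerSpan F q n j i a b
        (m := i.val + j.val + 2 - (a.val + b.val)) (by rw [Fin.lt_def] at H; omega))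
    have h4 := sub_mem
      (add_mem (Submodule.smul_mem _ (qIf q (a = b)) h2)
        (Submodule.smul_mem _ (lamIf q (b < a)) h3))
      (add_mem (Submodule.smul_mem _ (qIf q (i = j)) h1)
        (Submodule.smul_mem _ (lamIf q (i < j)) h3))
    convert h4 using 1
    simp only [map_add, map_smul, smul_add, mul_smul] at h ⊢
    rw [sub_eq_sub_iff_add_eq_add]
    refine Eq.trans (Eq.trans ?_ h) ?_
    · abel
    · abel

theorem map_monomSp {A B G : Type} [Ring A] [Ring B] [FunLike G A B] [RingHomClass G A B]
    (f : G) (n : ℕ) (s : Fin (2 * n) × Fin (2 * n) → A) (sI : Fin n → A)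
    (kN : Fin (2 * n) × Fin (2 * n) → ℕ) (kZ : Fin n → ℤ) :
    f (monomSp n s sI kN kZ) = monomSp n (fun p => f (s p)) (fun k => f (sI k)) kN kZ := by
  simp only [monomSp, map_list_prod, List.map_map, Function.comp_def, map_mul, map_pow, apply_ite]

theorem monomSp_mem_freeWords (kN : Fin (2 * n) × Fin (2 * n) → ℕ) (kZ : Fin n → ℤ) :
    monomSp n (fun p => SpFreeS F n p.1 p.2) (fun k => FreeAlgebra.ι F (Sum.inr k)) kN kZ ∈
      freeWords F (SpGen n) := by
  have hs (p : Fin (2 * n) × Fin (2 * n)) (m : ℕ) :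
      SpFreeS F n p.1 p.2 ^ m ∈ freeWords F (SpGen n) := pow_mem (ι_mem_freeWords _) m
  have hrow (l : List (Fin (2 * n) × Fin (2 * n))) :
      (l.map fun p => SpFreeS F n p.1 p.2 ^ kN p).prod ∈ freeWords F (SpGen n) := by
    refine list_prod_mem fun x hx => ?_
    obtain ⟨p, -, rfl⟩ := List.mem_map.1 hx
    exact hs _ _
  refine list_prod_mem fun x hx => ?_
  obtain ⟨k, -, rfl⟩ := List.mem_map.1 hx
  refine mul_mem (mul_mem (mul_mem (hrow _) ?_) (hs (fo n k, fo n k) _)) (hrow _)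
  split_ifs
  · exact hs (fe n k, fo n k) _
  · exact pow_mem (ι_mem_freeWords _) _

/-- The ordered monomials span `𝒮` over any field and for any nonzero parameter `q`. -/
theorem span_monomSp_eq_top {q : F} (hq : q ≠ 0) :
    Submodule.span F {x : AlgSp F q n | ∃ kN kZ,
      x = monomSp n (fun p => sSpP F q n p.1 p.2) (sInvP F q n) kN kZ} = ⊤ := by
  set mk := (leadCon (wtSp n) (projSp F q n)).mkₐ F
  let w (kN : Fin (2 * n) × Fin (2 * n) → ℕ) (kZ : Fin n → ℤ) : FreeAlgebra F (SpGen n) :=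
    monomSp n (fun p => SpFreeS F n p.1 p.2) (fun k => FreeAlgebra.ι F (Sum.inr k)) kN kZ
  have hgen : Algebra.adjoin F (Set.range (IsGradedSp.gen (fun i j => mk (SpFreeS F n i j))
      fun k => mk (FreeAlgebra.ι F (Sum.inr k)))) = ⊤ := by
    have hr : Set.range (IsGradedSp.gen (fun i j => mk (SpFreeS F n i j))
        fun k => mk (FreeAlgebra.ι F (Sum.inr k))) = mk '' Set.range (FreeAlgebra.ι F) := by
      rw [← Set.range_comp]
      refine congrArg Set.range (funext fun x => ?_)
      rcases x with x | x <;> rfl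
    rw [hr, ← AlgHom.map_adjoin, FreeAlgebra.adjoin_range_ι, Algebra.map_top]
    exact RingCon.range_mkₐ
  have hspan := (isGradedSp_leadCon F q n).span_monomSp_eq_top hq hgen
  have key := span_image_eq_top_of_leadCon (wt := wtSp n) (π := projSp F q n)
    (RingQuot.mkAlgHom_surjective F _) (T := {x | ∃ kN kZ, x = w kN kZ}) ?_ ?_
  · refine Eq.trans (congrArg (Submodule.span F) (Set.ext fun x => ⟨?_, ?_⟩)) key
    · rintro ⟨kN, kZ, rfl⟩
      exact ⟨_, ⟨kN, kZ, rfl⟩, map_monomSp _ _ _ _ _ _⟩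
    · rintro ⟨_, ⟨kN, kZ, rfl⟩, rfl⟩
      exact ⟨kN, kZ, map_monomSp _ _ _ _ _ _⟩
  · rintro _ ⟨kN, kZ, rfl⟩
    exact monomSp_mem_freeWords F n kN kZ
  · rw [← top_le_iff, ← hspan]
    refine Submodule.span_mono ?_
    rintro _ ⟨kN, kZ, rfl⟩
    exact ⟨_, ⟨kN, kZ, rfl⟩, map_monomSp _ _ _ _ _ _⟩

end Symplectic

/-- The symplectic algebra `𝒮` is spanned by the ordered monomials
`∏_i s_{i1}^{k_{i1}} ⋯ s_{ii'}^{k_{ii'}} s_{i'i'}^{k_{i'i'}} s_{i'1}^{k_{i'1}} ⋯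
s_{i',i'-2}^{k_{i',i'-2}}` with `k_{ii'} ∈ ℤ` and all other exponents in `ℕ`. -/
theorem stmt5 (n : ℕ) :
    Submodule.span FF
        {x : AlgSp FF qq n |
          ∃ (kN : Fin (2 * n) × Fin (2 * n) → ℕ) (kZ : Fin n → ℤ),
            x = monomSp n (fun p => sSpP FF qq n p.1 p.2) (sInvP FF qq n) kN kZ} = ⊤ :=
  span_monomSp_eq_top FF n RatFunc.X_ne_zero
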